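/- arXiv:1212.1700 — 4 statements merged into one kernel-verified Lean document; each statement's English description precedes it below -/
import Mathlib

section
/- Let A be a semi-pre-C*-algebra over ℂ. Then: (a) for x ∈ A, one has π(x) = 0 for every positive *-representation π of A on every complex Hilbert space if and only if ε·1 − x*x ∈ A₊ for every real ε > 0 (i.e. x is infinitesimal); (b) for hermitian a ∈ A, one has that π(a) is a positive operator for every positive *-representation π of A on every complex Hilbert space if and only if a + ε·1 ∈ A₊ for every real ε > 0 (i.e. a lies in the archimedean closure of A₊). -/
universe u

/-- A *-positive cone making a unital complex *-algebra `A` into a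
semi-pre-C*-algebra. -/
structure IsSemiPreCstarCone (A : Type*) [Ring A] [Algebra ℂ A] [StarRing A]
    (P : Set A) : Prop where
  herm : ∀ a ∈ P, star a = a
  smul_one_mem : ∀ t : ℝ, 0 ≤ t → ((t : ℂ) • (1 : A)) ∈ P
  smul_add_mem : ∀ l : ℝ, 0 ≤ l → ∀ a ∈ P, ∀ b ∈ P, (l : ℂ) • a + b ∈ P
  conj_mem : ∀ a ∈ P, ∀ x : A, star x * a * x ∈ P
  archimedean : ∀ x : A, ∃ R : ℝ, 0 < R ∧ (R : ℂ) • (1 : A) - star x * x ∈ P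


namespace SemiPreCstar

section cone

variable {A : Type u} [Ring A] [Algebra ℂ A] [StarRing A] {P : Set A}

lemma zero_mem (hP : IsSemiPreCstarCone A P) : (0 : A) ∈ P := by
  simpa using hP.smul_one_mem 0 le_rfl

lemma one_mem (hP : IsSemiPreCstarCone A P) : (1 : A) ∈ P := by
  simpa using hP.smul_one_mem 1 zero_le_one

lemma add_mem (hP : IsSemiPreCstarCone A P) {a b : A} (ha : a ∈ P) (hb : b ∈ P) :
    a + b ∈ P := by
  simpa using hP.smul_add_mem 1 zero_le_one a ha b hb

lemma smul_mem (hP : IsSemiPreCstarCone A P) {a : A} (ha : a ∈ P) {t : ℝ} (ht : 0 ≤ t) :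
    t • a ∈ P := by
  simpa using hP.smul_add_mem t ht a ha 0 (zero_mem hP)

lemma sq_mem (hP : IsSemiPreCstarCone A P) (x : A) : star x * x ∈ P := by
  simpa using hP.conj_mem 1 (one_mem hP) x

lemma star_real_smul (hP : IsSemiPreCstarCone A P) (t : ℝ) (x : A) :
    star (t • x) = t • star x := by
  have key : ∀ s : ℝ, 0 ≤ s → ∀ y : A, star (s • y) = s • star y := by
    intro s hs y
    have h1 : star (s • (1 : A)) = s • (1 : A) := by
      simpa using hP.herm _ (hP.smul_one_mem s hs)
    have h2 : s • y = (s • (1 : A)) * y := by simp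
    rw [h2, star_mul, h1]; simp
  rcases le_total 0 t with h | h
  · exact key t h x
  · have := key (-t) (by linarith) x
    simpa using this

lemma arch (hP : IsSemiPreCstarCone A P) (y : A) :
    ∃ t : ℝ, t • (1 : A) + (y + star y) ∈ P := by
  obtain ⟨R, -, hR⟩ := hP.archimedean (y - 1)
  refine ⟨R - 1, ?_⟩
  have := add_mem hP hR (sq_mem hP y)
  convert this using 1
  simp only [Complex.coe_smul, sub_smul, one_smul, star_sub, star_one, sub_mul, mul_sub, mul_one,
    one_mul]
  abel

/-- Separation: a positive functional negative at `a`. -/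
lemma exists_functional (hP : IsSemiPreCstarCone A P) (a : A) (ha : star a = a) (ε : ℝ)
    (hε : 0 < ε) (hn : a + (ε : ℂ) • (1 : A) ∉ P) :
    ∃ g : A →ₗ[ℝ] ℝ, (∀ b ∈ P, 0 ≤ g b) ∧ (∀ x, g (star x) = g x) ∧ g a < 0 := by
  rw [Complex.coe_smul] at hn
  set c : A := a + ε • (1 : A) with hc
  have hcs : star c = c := by rw [hc, star_add, ha, star_real_smul hP, star_one]
  let s : PointedCone ℝ A :=
    { carrier := {x | ∃ l : ℝ, 0 ≤ l ∧ (x + star x) + l • c ∈ P}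
      zero_mem' := ⟨0, le_rfl, by simpa using zero_mem hP⟩
      add_mem' := by
        rintro x y ⟨l, hl, hx⟩ ⟨m, hm, hy⟩
        refine ⟨l + m, add_nonneg hl hm, ?_⟩
        convert add_mem hP hx hy using 1
        rw [star_add, add_smul]; abel
      smul_mem' := by
        rintro ⟨t, ht⟩ x ⟨l, hl, hx⟩
        refine ⟨t * l, mul_nonneg ht hl, ?_⟩
        convert smul_mem hP hx ht using 1
        change t • x + star (t • x) + _ = _
        rw [star_real_smul hP, mul_smul, ← smul_add, ← smul_add] }
  have hs : ∀ x, x ∈ s ↔ ∃ l : ℝ, 0 ≤ l ∧ (x + star x) + l • c ∈ P := fun x => Iff.rfl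
  have hneg : ∀ t : ℝ, t • (1 : A) ∈ s → 0 ≤ t := by
    intro t ht
    by_contra hlt
    push Not at hlt
    obtain ⟨l, hl, h⟩ := (hs _).1 ht
    rw [star_real_smul hP, star_one] at h
    have h1 : l • c ∈ P := by
      have := add_mem hP h (smul_mem hP (one_mem hP) (t := -(2 * t)) (by linarith))
      convert this using 1
      module
    rcases hl.eq_or_lt with h0 | h0
    · subst h0
      have hm1 : (-1 : ℝ) • (1 : A) ∈ P := by
        have := smul_mem hP h (t := -(1 / (2 * t)))
          (by rw [neg_nonneg]; exact div_nonpos_of_nonneg_of_nonpos zero_le_one (by linarith))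
        convert this using 1
        rw [zero_smul, add_zero, ← add_smul, smul_smul]
        congr 1
        have ht0 : t ≠ 0 := hlt.ne
        field_simp
        norm_num
      obtain ⟨R, hR⟩ := arch hP ((1 / 2 : ℝ) • c)
      rw [star_real_smul hP, hcs, ← add_smul] at hR
      norm_num at hR
      have hR2 : |R| • (1 : A) + c ∈ P := by
        have := add_mem hP hR (smul_mem hP (one_mem hP) (t := |R| - R) (by linarith [le_abs_self R]))
        convert this using 1
        module
      apply hn
      have := add_mem hP hR2 (smul_mem hP hm1 (abs_nonneg R))
      convert this using 1
      module
    · apply hn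
      have := smul_mem hP h1 (t := l⁻¹) (by positivity)
      rwa [smul_smul, inv_mul_cancel₀ h0.ne', one_smul] at this
  have h1ne : (1 : A) ≠ 0 := by
    intro h
    have := hneg (-1) (by rw [h, smul_zero]; exact s.zero_mem)
    linarith
  let f : A →ₗ.[ℝ] ℝ := LinearPMap.mkSpanSingleton (1 : A) (1 : ℝ) h1ne
  have hf : ∀ (t : ℝ) (h : t • (1 : A) ∈ f.domain), f ⟨t • (1 : A), h⟩ = t := by
    intro t h
    have := LinearPMap.mkSpanSingleton'_apply (σ := RingHom.id ℝ) (1 : A) (1 : ℝ)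
      (by intro c hc; simpa [h1ne] using hc) t h
    simpa only [RingHom.id_apply, smul_eq_mul, mul_one] using! this
  have hdom : ∀ t : ℝ, t • (1 : A) ∈ f.domain := fun t =>
    Submodule.mem_span_singleton.2 ⟨t, rfl⟩
  obtain ⟨g, hg1, hg2⟩ := riesz_extension s f
    (by
      rintro ⟨x, hx⟩ hxs
      obtain ⟨t, rfl⟩ := Submodule.mem_span_singleton.1 hx
      rw [hf]; exact hneg t hxs)
    (by
      intro y
      obtain ⟨t, ht⟩ := arch hP y
      refine ⟨⟨(t / 2) • (1 : A), hdom _⟩, (hs _).2 ⟨0, le_rfl, ?_⟩⟩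
      convert ht using 1
      simp only [star_add, star_real_smul hP, star_one]
      module)
  have hgone : g 1 = 1 := by
    have := hg1 ⟨(1 : ℝ) • (1 : A), hdom 1⟩
    rw [hf] at this
    simpa using this
  refine ⟨g, ?_, ?_, ?_⟩
  · intro b hb
    refine hg2 b ((hs _).2 ⟨0, le_rfl, ?_⟩)
    rw [zero_smul, add_zero, hP.herm b hb]
    exact add_mem hP hb hb
  · intro x
    have h1 := hg2 (x - star x) ((hs _).2 ⟨0, le_rfl, by simpa using zero_mem hP⟩)
    have h2 := hg2 (star x - x) ((hs _).2 ⟨0, le_rfl, by simpa using zero_mem hP⟩)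
    rw [map_sub] at h1 h2
    linarith
  · have h1 := hg2 (-c) ((hs _).2 ⟨2, by norm_num, by
      rw [star_neg, hcs]
      convert zero_mem hP using 1
      module⟩)
    rw [hc, map_neg, map_add, map_smul, hgone, smul_eq_mul] at h1
    linarith

/-- The defect from conjugate-linearity of the involution is invisible to positive functionals. -/
lemma functional_I (hP : IsSemiPreCstarCone A P) (g : A →ₗ[ℝ] ℝ) (hg : ∀ b ∈ P, 0 ≤ g b)
    (hs : ∀ x, g (star x) = g x) (x : A) : g (Complex.I • star x) = - g (Complex.I • x) := by
  set j : A := Complex.I • (1 : A) with hj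
  set k : A := star j with hk
  have hjc : ∀ y, j * y = y * j := by intro y; simp [hj]
  have hkc : ∀ y, k * y = y * k := by
    intro y
    have := congrArg star (hjc (star y))
    simpa [hk] using this.symm
  have hjj : j * j = -1 := by simp [hj, smul_smul]
  have hkk : k * k = -1 := by
    have := congrArg star hjj
    simpa [hk] using this
  set m : A := k * j with hm
  have hmm : m * m = 1 := by
    calc m * m = k * (j * k) * j := by simp only [hm, mul_assoc]
      _ = k * k * (j * j) := by rw [hjc k]; simp only [mul_assoc]
      _ = 1 := by rw [hjj, hkk]; simp
  have hms : star m = m := by simp [hm, hk]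
  have hmc : ∀ y, m * y = y * m := by
    intro y
    rw [hm, mul_assoc, hjc, ← mul_assoc, hkc, mul_assoc]
  have hmP : m ∈ P := sq_mem hP j
  have hp1 : (2 : ℝ) • (1 - m) ∈ P := by
    convert sq_mem hP (1 - m) using 1
    rw [star_sub, star_one, hms]
    simp only [sub_mul, mul_sub, hmm, two_smul, one_mul, mul_one]; abel
  have hp2 : (2 : ℝ) • (m - 1) ∈ P := by
    convert hP.conj_mem m hmP (1 - m) using 1
    rw [star_sub, star_one, hms]
    simp only [sub_mul, mul_sub, hmm, two_smul, one_mul, mul_one]; abel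
  have hz : ∀ z, g ((1 - m) * (star z * z)) = 0 := by
    intro z
    have e : star z * ((2 : ℝ) • (1 - m)) * z = (2 : ℝ) • ((1 - m) * (star z * z)) := by
      simp only [mul_smul_comm, smul_mul_assoc]
      congr 1
      simp only [mul_sub, sub_mul, mul_one, one_mul, ← hmc, mul_assoc]
    have e' : star z * ((2 : ℝ) • (m - 1)) * z = (2 : ℝ) • (-((1 - m) * (star z * z))) := by
      rw [smul_neg, ← e, ← neg_sub 1 m]
      simp only [smul_neg, mul_neg, neg_mul]
    have h1 := hg _ (hP.conj_mem _ hp1 z)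
    have h2 := hg _ (hP.conj_mem _ hp2 z)
    rw [e, map_smul, smul_eq_mul] at h1
    rw [e', map_smul, map_neg, smul_eq_mul] at h2
    linarith
  have hy : ∀ y, g ((1 - m) * y) = 0 := by
    intro y
    have h1 : g ((1 - m) * star y) = g ((1 - m) * y) := by
      rw [← hs ((1 - m) * y)]
      congr 1
      rw [star_mul, star_sub, star_one, hms, sub_mul, mul_sub, hmc, one_mul, mul_one]
    have h2 := hz (1 + y)
    have e : (1 - m) * (star (1 + y) * (1 + y)) = (1 - m) * (star 1 * 1) + (1 - m) * y
        + (1 - m) * star y + (1 - m) * (star y * y) := by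
      rw [← mul_add, ← mul_add, ← mul_add]
      congr 1
      rw [star_add, add_mul, mul_add, mul_add]
      simp only [star_one, one_mul, mul_one]; abel
    rw [e, map_add, map_add, map_add, hz, hz, h1] at h2
    linarith
  have hIx : ∀ y : A, Complex.I • y = j * y := by intro y; simp [hj]
  have hw : (1 - m) * (j * x) = j * x + k * x := by
    rw [sub_mul, one_mul, hm, ← mul_assoc, mul_assoc k j j, hjj]; simp
  have h3 := hy (j * x)
  rw [hw, map_add] at h3
  have h4 : g (j * star x) = g (k * x) := by
    rw [← hs (j * star x), star_mul, star_star, hkc]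
  rw [hIx, hIx, h4]
  linarith

/-- The complexification of a real functional. -/
noncomputable def cplx (g : A →ₗ[ℝ] ℝ) : A →ₗ[ℂ] ℂ where
  toFun x := ⟨g x, - g (Complex.I • x)⟩
  map_add' x y := by
    apply Complex.ext <;> simp [smul_add] <;> ring
  map_smul' c x := by
    have h : ∀ y : A, c • y = c.re • y + c.im • (Complex.I • y) := by
      intro y
      conv_lhs => rw [← Complex.re_add_im c]
      rw [add_smul, mul_smul, Complex.coe_smul, Complex.coe_smul]
    have h2 : Complex.I • c • x = c.re • (Complex.I • x) - c.im • x := by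
      rw [smul_comm, h (Complex.I • x), smul_smul Complex.I]; simp [sub_eq_add_neg]
    apply Complex.ext
    · simp only [h x, map_add, map_smul]
      simp
    · simp only [h2, map_sub, map_smul]
      simp; ring

lemma cplx_re (g : A →ₗ[ℝ] ℝ) (x : A) : (cplx g x).re = g x := rfl

lemma cplx_star (hP : IsSemiPreCstarCone A P) (g : A →ₗ[ℝ] ℝ) (hg : ∀ b ∈ P, 0 ≤ g b)
    (hs : ∀ x, g (star x) = g x) (x : A) :
    cplx g (star x) = (starRingEnd ℂ) (cplx g x) := by
  apply Complex.ext
  · simp [cplx, hs]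
  · simp [cplx, functional_I hP g hg hs]

/-- Abstract completion of a bounded *-action. -/
lemma exists_completion {V : Type u} [SeminormedAddCommGroup V] [InnerProductSpace ℂ V]
    (ρ : A →ₐ[ℂ] Module.End ℂ V)
    (hb : ∀ a, ∃ C : ℝ, ∀ v, ‖ρ a v‖ ≤ C * ‖v‖)
    (hst : ∀ a v w, inner ℂ (ρ (star a) v) w = inner ℂ v (ρ a w))
    (hpos : ∀ b ∈ P, star b = b ∧ ∀ v, 0 ≤ (inner ℂ v (ρ b v)).re) :
    ∃ π : A →ₐ[ℂ] (UniformSpace.Completion V →L[ℂ] UniformSpace.Completion V),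
      (∀ y : A, π (star y) = ContinuousLinearMap.adjoint (π y)) ∧
      (∀ b ∈ P, (π b).IsPositive) ∧
      ∀ a (v : V), π a (v : UniformSpace.Completion V) = ((ρ a v : V) : UniformSpace.Completion V) := by
  choose C hC using hb
  let T : A → (V →L[ℂ] V) := fun a => (ρ a).mkContinuous (C a) (hC a)
  have hT : ∀ a v, T a v = ρ a v := fun a v => rfl
  let p : A → (UniformSpace.Completion V →L[ℂ] UniformSpace.Completion V) :=
    fun a => (T a).completion
  have hp : ∀ a (v : V), p a (v : UniformSpace.Completion V)
      = ((ρ a v : V) : UniformSpace.Completion V) := by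
    intro a v
    exact ContinuousLinearMap.completion_apply_coe (T a) v
  have hext : ∀ S S' : UniformSpace.Completion V →L[ℂ] UniformSpace.Completion V,
      (∀ v : V, S v = S' v) → S = S' := by
    intro S S' h
    ext c
    induction c using UniformSpace.Completion.induction_on with
    | hp => exact isClosed_eq S.continuous S'.continuous
    | ih c => exact h c
  have hadj : ∀ y, p (star y) = ContinuousLinearMap.adjoint (p y) := by
    intro y
    refine (ContinuousLinearMap.eq_adjoint_iff _ _).mpr ?_
    intro x z
    induction x, z using UniformSpace.Completion.induction_on₂ with
    | hp => apply isClosed_eq <;> fun_prop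
    | ih x z => rw [hp, hp, UniformSpace.Completion.inner_coe, UniformSpace.Completion.inner_coe, hst]
  let π : A →ₐ[ℂ] (UniformSpace.Completion V →L[ℂ] UniformSpace.Completion V) :=
    AlgHom.ofLinearMap
      { toFun := p
        map_add' := fun x y => hext _ _ fun v => by
          simp only [add_apply, hp, map_add, LinearMap.add_apply, UniformSpace.Completion.coe_add]
        map_smul' := fun c x => hext _ _ fun v => by
          simp only [smul_apply, hp, map_smul, LinearMap.smul_apply,
            UniformSpace.Completion.coe_smul, RingHom.id_apply] }
      (hext _ _ fun v => by
        change p 1 v = _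
        simp [hp])
      (fun x y => hext _ _ fun v => by
        change p (x * y) v = p x (p y v)
        simp [hp])
  refine ⟨π, hadj, ?_, hp⟩
  intro b hb
  obtain ⟨h1, h2⟩ := hpos b hb
  change (p b).IsPositive
  refine ContinuousLinearMap.isPositive_def'.2 ⟨?_, ?_⟩
  · rw [ContinuousLinearMap.isSelfAdjoint_iff', ← hadj, h1]
  · intro x
    induction x using UniformSpace.Completion.induction_on with
    | hp =>
      exact isClosed_le continuous_const (p b).reApplyInnerSelf_continuous
    | ih x =>
      rw [ContinuousLinearMap.reApplyInnerSelf, hp, UniformSpace.Completion.inner_coe,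
        inner_re_symm]
      exact h2 x

/-- GNS construction. -/
lemma gns (hP : IsSemiPreCstarCone A P) (g : A →ₗ[ℝ] ℝ) (hg : ∀ b ∈ P, 0 ≤ g b)
    (hs : ∀ x, g (star x) = g x) (a : A)
    (H : ∀ (H : Type u) [NormedAddCommGroup H] [InnerProductSpace ℂ H] [CompleteSpace H]
          (π : A →ₐ[ℂ] (H →L[ℂ] H)),
          (∀ y : A, π (star y) = ContinuousLinearMap.adjoint (π y)) →
          (∀ b ∈ P, (π b).IsPositive) → (π a).IsPositive) : 0 ≤ g a := by
  have hstar := cplx_star hP g hg hs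
  let core : PreInnerProductSpace.Core ℂ A :=
    { inner := fun x y => cplx g (star x * y)
      conj_inner_symm := fun x y => by rw [← hstar]; simp
      re_inner_nonneg := fun x => hg _ (sq_mem hP x)
      add_left := fun x y z => by rw [star_add, add_mul, map_add]
      smul_left := fun x y r => by
        have h : ∀ x y : A, cplx g (star x * y) = (starRingEnd ℂ) (cplx g (star y * x)) := by
          intro x y; rw [← hstar]; simp
        rw [h (r • x) y, h x y, mul_smul_comm, map_smul, smul_eq_mul, map_mul] }
  let _ : SeminormedAddCommGroup A := InnerProductSpace.Core.toSeminormedAddCommGroup (c := core)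
  let _ : InnerProductSpace ℂ A := InnerProductSpace.ofCore core
  have hin : ∀ x y : A, inner ℂ x y = cplx g (star x * y) := fun x y => rfl
  have hnorm : ∀ x : A, ‖x‖ ^ 2 = g (star x * x) := by
    intro x
    have := inner_self_eq_norm_sq (𝕜 := ℂ) x
    rw [← this, hin]; rfl
  obtain ⟨π, h1, h2, h3⟩ := exists_completion (P := P) (Algebra.lmul ℂ A)
    (by
      intro a
      obtain ⟨R, hR0, hR⟩ := hP.archimedean a
      refine ⟨√R, fun v => ?_⟩
      refine (sq_le_sq₀ (norm_nonneg _) (by positivity)).1 ?_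
      rw [mul_pow, Real.sq_sqrt hR0.le, hnorm, hnorm]
      have h := hg _ (hP.conj_mem _ hR v)
      have e : star v * ((R : ℂ) • (1 : A) - star a * a) * v
          = R • (star v * v) - star (a * v) * (a * v) := by
        simp [mul_sub, sub_mul, mul_assoc]
      rw [e, map_sub, map_smul, smul_eq_mul] at h
      simpa using h)
    (by
      intro a v w
      rw [hin, hin]
      simp [mul_assoc])
    (by
      intro b hb
      refine ⟨hP.herm b hb, fun v => ?_⟩
      rw [hin]
      have := hg _ (hP.conj_mem b hb v)
      simpa [cplx_re, mul_assoc] using this)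
  have h4 := (H _ π h1 h2).re_inner_nonneg_right ((1 : A) : UniformSpace.Completion A)
  rw [h3, UniformSpace.Completion.inner_coe, hin] at h4
  simpa [cplx_re] using h4

lemma closure_iff (hP : IsSemiPreCstarCone A P) (a : A) (ha : star a = a) :
    (∀ (H : Type u) [NormedAddCommGroup H] [InnerProductSpace ℂ H] [CompleteSpace H]
          (π : A →ₐ[ℂ] (H →L[ℂ] H)),
          (∀ y : A, π (star y) = ContinuousLinearMap.adjoint (π y)) →
          (∀ b ∈ P, (π b).IsPositive) → (π a).IsPositive)
        ↔ (∀ ε : ℝ, 0 < ε → a + (ε : ℂ) • (1 : A) ∈ P) := by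
  constructor
  · intro H ε hε
    by_contra hn
    obtain ⟨g, hg, hs, hlt⟩ := exists_functional hP a ha ε hε hn
    exact absurd (gns hP g hg hs a H) (not_le.2 hlt)
  · intro h H _ _ _ π h1 h2
    refine ContinuousLinearMap.isPositive_def'.2 ⟨?_, ?_⟩
    · rw [ContinuousLinearMap.isSelfAdjoint_iff', ← h1, ha]
    · intro x
      rw [ContinuousLinearMap.reApplyInnerSelf]
      by_contra hlt
      push Not at hlt
      set r := RCLike.re (inner ℂ (π a x) x) with hr
      have key : ∀ ε : ℝ, 0 < ε → 0 ≤ r + ε * ‖x‖ ^ 2 := by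
        intro ε hε
        have := (h2 _ (h ε hε)).re_inner_nonneg_left x
        rw [map_add, map_smul, map_one, add_apply, inner_add_left, map_add] at this
        convert this using 2
        rw [smul_apply, show (1 : H →L[ℂ] H) x = x from rfl, inner_smul_left]
        simp [← inner_self_eq_norm_sq (𝕜 := ℂ) x]
      have := key (-r / (2 * (‖x‖ ^ 2 + 1))) (div_pos (by linarith) (by positivity))
      have h5 : -r / (2 * (‖x‖ ^ 2 + 1)) * ‖x‖ ^ 2 ≤ -r / 2 := by
        rw [div_mul_eq_mul_div, div_le_div_iff₀ (by positivity) (by norm_num)]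
        nlinarith [sq_nonneg ‖x‖]
      linarith

end cone

end SemiPreCstar

/-- (a) An element `x` of a semi-pre-C*-algebra is killed by every positive
*-representation on a Hilbert space iff it is infinitesimal
(`ε·1 − x*x ∈ A₊` for all `ε > 0`); (b) a hermitian `a` is mapped to a positive
operator by every positive *-representation iff `a` lies in the archimedean closure
of `A₊` (`a + ε·1 ∈ A₊` for all `ε > 0`). -/
theorem kernel_and_arch_closure_via_positive_representations
    {A : Type u} [Ring A] [Algebra ℂ A] [StarRing A]
    (P : Set A) (hP : IsSemiPreCstarCone A P) :
    (∀ x : A,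
      ((∀ (H : Type u) [NormedAddCommGroup H] [InnerProductSpace ℂ H] [CompleteSpace H]
          (π : A →ₐ[ℂ] (H →L[ℂ] H)),
          (∀ y : A, π (star y) = ContinuousLinearMap.adjoint (π y)) →
          (∀ b ∈ P, (π b).IsPositive) → π x = 0)
        ↔ (∀ ε : ℝ, 0 < ε → (ε : ℂ) • (1 : A) - star x * x ∈ P)))
    ∧
    (∀ a : A, star a = a →
      ((∀ (H : Type u) [NormedAddCommGroup H] [InnerProductSpace ℂ H] [CompleteSpace H]
          (π : A →ₐ[ℂ] (H →L[ℂ] H)),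
          (∀ y : A, π (star y) = ContinuousLinearMap.adjoint (π y)) →
          (∀ b ∈ P, (π b).IsPositive) → (π a).IsPositive)
        ↔ (∀ ε : ℝ, 0 < ε → a + (ε : ℂ) • (1 : A) ∈ P))) := by
  refine ⟨fun x => ?_, fun a ha => SemiPreCstar.closure_iff hP a ha⟩
  have hh : star (-(star x * x)) = -(star x * x) := by simp
  have key := SemiPreCstar.closure_iff hP (-(star x * x)) hh
  have e : ∀ ε : ℝ, (ε : ℂ) • (1 : A) - star x * x = -(star x * x) + (ε : ℂ) • (1 : A) := by
    intro ε; abel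
  simp only [e]
  rw [← key]
  constructor
  · intro h H _ _ _ π h1 h2
    rw [map_neg, map_mul, h H π h1 h2, mul_zero, neg_zero]
    exact ContinuousLinearMap.isPositive_zero
  · intro h H _ _ _ π h1 h2
    ext v
    have h3 := (h H π h1 h2).re_inner_nonneg_right v
    rw [map_neg, map_mul, h1, neg_apply, inner_neg_right, mul_apply_eq_comp,
      ContinuousLinearMap.adjoint_inner_right, map_neg, inner_self_eq_norm_sq] at h3
    have : ‖π x v‖ = 0 := by nlinarith [sq_nonneg ‖π x v‖]
    simpa using this
end

section
/- Let d ∈ ℕ and let f ∈ ℝ[X₁,…,X_d] be a real polynomial in d commuting variables. Then f(t₁,…,t_d) ≥ 0 for all (t₁,…,t_d) ∈ [−1,1]^d if and only if for every real ε > 0 there exist finitely many polynomials p_k and q_{i,k} in ℝ[X₁,…,X_d] such that f + ε = Σ_k p_k² + Σ_{i=1}^d Σ_k q_{i,k}² · (1 − X_i²). -/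
open MvPolynomial

namespace HC

/-- the quadratic module -/
inductive QM (d : ℕ) : MvPolynomial (Fin d) ℝ → Prop
  | sq (p : MvPolynomial (Fin d) ℝ) : QM d (p ^ 2)
  | gen (q : MvPolynomial (Fin d) ℝ) (i : Fin d) : QM d (q ^ 2 * (1 - X i ^ 2))
  | add {p q : MvPolynomial (Fin d) ℝ} : QM d p → QM d q → QM d (p + q)

variable {d : ℕ}

lemma QM.rep {f : MvPolynomial (Fin d) ℝ} (h : QM d f) :
    ∃ (n m : ℕ) (p : Fin n → MvPolynomial (Fin d) ℝ)
          (q : Fin d → Fin m → MvPolynomial (Fin d) ℝ),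
          f = (∑ k, p k ^ 2) + ∑ i, ∑ k, q i k ^ 2 * (1 - X i ^ 2) := by
  induction h with
  | sq p => exact ⟨1, 0, fun _ => p, fun _ _ => 0, by simp⟩
  | gen q i =>
    refine ⟨0, 1, fun _ => 0, fun j _ => if j = i then q else 0, ?_⟩
    simp [ite_pow, ite_mul]
  | add _ _ h1 h2 =>
    obtain ⟨n, m, p, q, rfl⟩ := h1
    obtain ⟨n', m', p', q', rfl⟩ := h2
    refine ⟨n + n', m + m', Fin.append p p', fun i => Fin.append (q i) (q' i), ?_⟩
    simp only [Fin.sum_univ_add, Fin.append_left, Fin.append_right, Finset.sum_add_distrib]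
    ring

lemma QM.congr {p q : MvPolynomial (Fin d) ℝ} (h : QM d p) (e : q = p) : QM d q := e ▸ h

lemma QM.mul_sq {p : MvPolynomial (Fin d) ℝ} (h : QM d p) (s : MvPolynomial (Fin d) ℝ) :
    QM d (s ^ 2 * p) := by
  induction h with
  | sq p => exact (QM.sq (s * p)).congr (by ring)
  | gen q i => exact (QM.gen (s * q) i).congr (by ring)
  | add _ _ h1 h2 => exact (h1.add h2).congr (by ring)

lemma C_eq_sq {a : ℝ} (ha : 0 ≤ a) : (C a : MvPolynomial (Fin d) ℝ) = C (√a) ^ 2 := by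
  rw [← C_pow, Real.sq_sqrt ha]

lemma QM.smul {p : MvPolynomial (Fin d) ℝ} (h : QM d p) {a : ℝ} (ha : 0 ≤ a) :
    QM d (C a * p) := by
  rw [C_eq_sq ha]; exact h.mul_sq _

lemma QM.const {a : ℝ} (ha : 0 ≤ a) : QM d (C a) := by
  rw [C_eq_sq ha]; exact .sq _

lemma QM.gen' (i : Fin d) : QM d (1 - X i ^ 2) := (QM.gen 1 i).congr (by ring)

lemma arch_sq (p : MvPolynomial (Fin d) ℝ) : ∃ r : ℝ, 0 ≤ r ∧ QM d (C r - p ^ 2) := by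
  induction p using MvPolynomial.induction_on with
  | C a => exact ⟨a ^ 2, sq_nonneg a, (QM.const le_rfl).congr (by simp)⟩
  | add p q hp hq =>
    obtain ⟨r, hr, h1⟩ := hp
    obtain ⟨s, hs, h2⟩ := hq
    refine ⟨2 * r + 2 * s, by positivity, ?_⟩
    refine (((h1.smul (a := 2) (by norm_num)).add (h2.smul (a := 2) (by norm_num))).add
      (.sq (p - q))).congr ?_
    simp only [C_add, C_mul, map_ofNat]
    ring
  | mul_X p i hp =>
    obtain ⟨r, hr, h1⟩ := hp
    refine ⟨r, hr, (((QM.gen' i).smul hr).add (h1.mul_sq (X i))).congr ?_⟩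
    ring

lemma C_half : (C (1/2 : ℝ) : MvPolynomial (Fin d) ℝ) * 2 = 1 := by
  rw [← map_ofNat C 2, ← C_mul]; norm_num

lemma arch (p : MvPolynomial (Fin d) ℝ) : ∃ r : ℝ, 0 ≤ r ∧ QM d (C r - p) := by
  obtain ⟨r, hr, h⟩ := arch_sq p
  refine ⟨r + (1/2) * (1/2), by positivity, (h.add (.sq (p - C (1/2)))).congr ?_⟩
  rw [C_add, C_mul]
  linear_combination p * C_half

/-- `e` multiplies the module into itself and is bounded by `δ` -/
def P (d : ℕ) (e : MvPolynomial (Fin d) ℝ) (δ : ℝ) : Prop :=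
  (∀ p, QM d p → QM d (e * p)) ∧ 0 ≤ δ ∧ QM d (C δ - e)

lemma P.add {e e' : MvPolynomial (Fin d) ℝ} {δ δ' : ℝ} (h : P d e δ) (h' : P d e' δ') :
    P d (e + e') (δ + δ') :=
  ⟨fun p hp => ((h.1 p hp).add (h'.1 p hp)).congr (by ring), add_nonneg h.2.1 h'.2.1,
    (h.2.2.add h'.2.2).congr (by rw [C_add]; ring)⟩

lemma P.mul {e e' : MvPolynomial (Fin d) ℝ} {δ δ' : ℝ} (h : P d e δ) (h' : P d e' δ') :
    P d (e * e') (δ * δ') :=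
  ⟨fun p hp => (h.1 _ (h'.1 p hp)).congr (by ring), mul_nonneg h.2.1 h'.2.1,
    ((h'.2.2.smul h.2.1).add (h'.1 _ h.2.2)).congr (by rw [C_mul]; ring)⟩

lemma P.const {a : ℝ} (ha : 0 ≤ a) : P d (C a) a :=
  ⟨fun _ hp => hp.smul ha, ha, (QM.const le_rfl).congr (by simp)⟩

lemma P.X2 (i : Fin d) : P d (X i ^ 2) 1 :=
  ⟨fun _ hp => hp.mul_sq _, zero_le_one, (QM.gen' i).congr (by simp)⟩

noncomputable def u (i : Fin d) : ℕ → MvPolynomial (Fin d) ℝ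
  | 0 => 0
  | n + 1 => C (1/2) * (X i ^ 2 + u i n * u i n)

noncomputable def v : ℕ → ℝ
  | 0 => 0
  | n + 1 => (1/2) * (1 + v n * v n)

lemma P_u (i : Fin d) (n : ℕ) : P d (u i n) (v n) := by
  induction n with
  | zero => simpa [u, v] using P.const (d := d) le_rfl
  | succ n ih => exact (P.const (by norm_num)).mul ((P.X2 i).add (ih.mul ih))

lemma P_diff (i : Fin d) (n : ℕ) : P d (u i (n + 1) - u i n) (v (n + 1) - v n) := by
  induction n with
  | zero =>
    have := (P.const (d := d) (a := 1/2) (by norm_num)).mul (P.X2 i)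
    simpa [u, v] using this
  | succ n ih =>
    have := ((P.const (d := d) (a := 1/2) (by norm_num)).mul ((P_u i (n+1)).add (P_u i n))).mul ih
    convert this using 1
    · rw [u, u.eq_2 i n]; rw [← u.eq_2 i n]; ring_nf; rw [u]; ring
    · rw [v, v.eq_2 n]; rw [← v.eq_2 n]; ring_nf; rw [v]; ring

lemma v_small (ε : ℝ) (hε : 0 < ε) : ∃ n, v (n + 1) - v n < ε := by
  have hmono : Monotone v := by
    apply monotone_nat_of_le_succ
    intro n
    simp only [v]
    nlinarith [sq_nonneg (v n - 1)]
  have hb : ∀ n, 0 ≤ v n ∧ v n ≤ 1 := by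
    intro n
    induction n with
    | zero => simp [v]
    | succ n ih =>
      simp only [v]
      constructor <;> nlinarith
  have hl := tendsto_atTop_ciSup hmono ⟨1, by rintro _ ⟨n, rfl⟩; exact (hb n).2⟩
  have h2 := ((Filter.tendsto_add_atTop_iff_nat 1).2 hl).sub hl
  rw [sub_self] at h2
  exact (h2.eventually (gt_mem_nhds hε)).exists

/-- closure of the module -/
def QMb (d : ℕ) (p : MvPolynomial (Fin d) ℝ) : Prop := ∀ ε : ℝ, 0 < ε → QM d (p + C ε)

lemma QM.toQMb {p : MvPolynomial (Fin d) ℝ} (h : QM d p) : QMb d p :=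
  fun _ hε => h.add (.const hε.le)

lemma QM.mul_gen {p : MvPolynomial (Fin d) ℝ} (h : QM d p) (i : Fin d) :
    QMb d ((1 - X i ^ 2) * p) := by
  intro ε hε
  obtain ⟨N, hN, hNp⟩ := arch p
  obtain ⟨n, hn⟩ := v_small (ε / (2 * (N + 1))) (by positivity)
  obtain ⟨h1, h2, h3⟩ := P_diff i n
  have h4 : 0 ≤ ε - 2 * (N * (v (n + 1) - v n)) := by
    rw [lt_div_iff₀ (by positivity)] at hn
    nlinarith
  refine ((((h.mul_sq (1 - u i n)).add ((h1 _ hNp).smul (a := 2) (by norm_num))).add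
    (h3.smul (a := 2 * N) (by positivity))).add (QM.const h4)).congr ?_
  have h5 : u i (n + 1) = C (1/2) * (X i ^ 2 + u i n * u i n) := rfl
  rw [h5]
  simp only [C_sub, C_mul, map_ofNat]
  linear_combination (p * (X i ^ 2 + u i n * u i n)) * C_half (d := d)

lemma QMb.add {p q : MvPolynomial (Fin d) ℝ} (h : QMb d p) (h' : QMb d q) : QMb d (p + q) := by
  intro ε hε
  refine ((h (ε/2) (by positivity)).add (h' (ε/2) (by positivity))).congr ?_
  rw [← add_halves ε, C_add, add_halves]; ring

lemma QMb.congr {p q : MvPolynomial (Fin d) ℝ} (h : QMb d p) (e : q = p) : QMb d q := e ▸ h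

lemma QMb.of_QMb {p : MvPolynomial (Fin d) ℝ} (h : ∀ ε : ℝ, 0 < ε → QMb d (p + C ε)) :
    QMb d p := by
  intro ε hε
  refine (h (ε/2) (by positivity) (ε/2) (by positivity)).congr ?_
  rw [← add_halves ε, C_add, add_halves]; ring

lemma QMb.mul_sq {p : MvPolynomial (Fin d) ℝ} (h : QMb d p) (s : MvPolynomial (Fin d) ℝ) :
    QMb d (s ^ 2 * p) := by
  intro ε hε
  obtain ⟨N, hN, hs⟩ := arch (s ^ 2)
  have e : ε = ε / (N + 1) * N + ε / (N + 1) := by field_simp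
  have hp : 0 < ε / (N + 1) := by positivity
  refine ((((h _ hp).mul_sq s).add (hs.smul hp.le)).add (QM.const hp.le)).congr ?_
  conv_lhs => rw [e]
  rw [C_add, C_mul]; ring

lemma QMb.mul_gen {p : MvPolynomial (Fin d) ℝ} (h : QMb d p) (i : Fin d) :
    QMb d ((1 - X i ^ 2) * p) := by
  apply QMb.of_QMb
  intro ε hε
  refine (((h ε hε).mul_gen i).add ((QM.const hε.le).mul_sq (X i)).toQMb).congr ?_
  ring

lemma QMb.smul {p : MvPolynomial (Fin d) ℝ} (h : QMb d p) {a : ℝ} (ha : 0 ≤ a) :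
    QMb d (C a * p) := by
  rw [C_eq_sq ha]; exact h.mul_sq _

/-- affine change of variables -/
noncomputable def Y (i : Fin d) : MvPolynomial (Fin d) ℝ := C (1/2) * (1 + X i)

lemma QMb.mul_Y {p : MvPolynomial (Fin d) ℝ} (h : QMb d p) (i : Fin d) : QMb d (Y i * p) := by
  refine ((h.mul_sq (Y i)).add ((h.mul_gen i).smul (a := 1/2 * (1/2)) (by norm_num))).congr ?_
  rw [Y, C_mul]
  linear_combination (- p * (1 + X i) * C (1/2)) * C_half (d := d)

lemma QMb.mul_Y' {p : MvPolynomial (Fin d) ℝ} (h : QMb d p) (i : Fin d) :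
    QMb d ((1 - Y i) * p) := by
  refine ((h.mul_sq (1 - Y i)).add ((h.mul_gen i).smul (a := 1/2 * (1/2)) (by norm_num))).congr ?_
  rw [Y, C_mul]
  linear_combination (- p * (1 + X i) * C (1/2)) * C_half (d := d)

/-- Bernstein basis element -/
noncomputable def B (n j : ℕ) (i : Fin d) : MvPolynomial (Fin d) ℝ :=
  C (n.choose j : ℝ) * (Y i ^ j * (1 - Y i) ^ (n - j))

lemma QMb.mul_B {p : MvPolynomial (Fin d) ℝ} (h : QMb d p) (n j : ℕ) (i : Fin d) :
    QMb d (B n j i * p) := by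
  have h1 : ∀ k, ∀ p, QMb d p → QMb d (Y i ^ k * p) := by
    intro k
    induction k with
    | zero => intro p hp; simpa using hp
    | succ k ih => intro p hp; exact (ih _ (hp.mul_Y i)).congr (by ring)
  have h2 : ∀ k, ∀ p, QMb d p → QMb d ((1 - Y i) ^ k * p) := by
    intro k
    induction k with
    | zero => intro p hp; simpa using hp
    | succ k ih => intro p hp; exact (ih _ (hp.mul_Y' i)).congr (by ring)
  refine ((h1 j _ (h2 (n - j) p h)).smul (a := (n.choose j : ℝ)) (by positivity)).congr ?_
  rw [B]; ring

lemma QMb_prod (n : ℕ) (J : Fin d → ℕ) (s : Finset (Fin d)) :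
    QMb d (∏ i ∈ s, B n (J i) i) := by
  classical
  induction s using Finset.induction_on with
  | empty => simpa using (QM.sq (1 : MvPolynomial (Fin d) ℝ)).toQMb
  | insert i s hi ih => rw [Finset.prod_insert hi]; exact ih.mul_B _ _ _

lemma QMb_sum {ι : Type*} (s : Finset ι) (g : ι → MvPolynomial (Fin d) ℝ)
    (h : ∀ j ∈ s, QMb d (g j)) : QMb d (∑ j ∈ s, g j) := by
  classical
  induction s using Finset.induction_on with
  | empty => simpa using (QM.const (d := d) le_rfl).toQMb
  | insert i s hi ih =>
    rw [Finset.sum_insert hi]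
    exact (h i (by simp)).add (ih fun j hj => h j (by simp [hj]))

noncomputable def r (n j k : ℕ) : ℝ := (j.descFactorial k : ℝ) / n.descFactorial k

lemma Y_pow (n k : ℕ) (hk : k ≤ n) (i : Fin d) :
    Y i ^ k = ∑ j ∈ Finset.range (n + 1), C (r n j k) * B n j i := by
  obtain ⟨m, rfl⟩ := Nat.exists_eq_add_of_le hk
  have h0 : ∀ j ∈ Finset.range k, C (r (k + m) j k) * B (k + m) j i = 0 := by
    intro j hj
    rw [r, Nat.descFactorial_eq_zero_iff_lt.2 (Finset.mem_range.1 hj)]; simp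
  rw [add_assoc, Finset.sum_range_add, Finset.sum_eq_zero h0, zero_add]
  have h1 : Y i ^ k = Y i ^ k * (Y i + (1 - Y i)) ^ m := by simp
  rw [h1, add_pow, Finset.mul_sum]
  refine Finset.sum_congr rfl fun j hj => ?_
  have hj : j ≤ m := Nat.lt_succ_iff.1 (Finset.mem_range.1 hj)
  have h2 : r (k + m) (k + j) k * ((k + m).choose (k + j) : ℝ) = m.choose j := by
    have h3 : ((k + m).descFactorial k : ℝ) ≠ 0 := by
      rw [Nat.cast_ne_zero, Ne, Nat.descFactorial_eq_zero_iff_lt]; omega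
    rw [r, div_mul_eq_mul_div, div_eq_iff h3]
    norm_cast
    rw [Nat.descFactorial_eq_factorial_mul_choose, Nat.descFactorial_eq_factorial_mul_choose]
    have h4 := Nat.choose_mul (n := k + m) (k := k + j) (s := k) (by omega)
    simp only [Nat.add_sub_cancel_left] at h4
    linear_combination (k.factorial) * h4
  rw [B, ← mul_assoc (C _) (C _), ← C_mul, h2, Nat.add_sub_add_left, pow_add, C_eq_coe_nat]
  ring

lemma r_mem (n j k : ℕ) (h : j ≤ n) : 0 ≤ r n j k ∧ r n j k ≤ 1 := by
  refine ⟨by unfold r; positivity, ?_⟩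
  unfold r
  apply div_le_one_of_le₀ _ (by positivity)
  exact_mod_cast Nat.descFactorial_le k h

lemma r_lim (k : ℕ) : ∀ ε : ℝ, 0 < ε → ∀ᶠ n : ℕ in Filter.atTop, ∀ j ≤ n,
    |r n j k - ((j : ℝ) / n) ^ k| ≤ ε := by
  induction k with
  | zero => intro ε hε; exact .of_forall fun n j _ => by simp [r, hε.le]
  | succ k ih =>
    intro ε hε
    have ht : Filter.Tendsto (fun n : ℕ => (k : ℝ) / ((n : ℝ) - k)) Filter.atTop (nhds 0) :=
      Filter.Tendsto.const_div_atTop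
        (Filter.tendsto_atTop_add_const_right _ (-(k:ℝ)) tendsto_natCast_atTop_atTop) _
    filter_upwards [ih (ε/2) (by positivity), ht.eventually (ge_mem_nhds (half_pos hε)),
      Filter.eventually_gt_atTop k] with n h1 h2 h3 j hj
    have hn : (k : ℝ) < n := by exact_mod_cast h3
    have hjn : (j : ℝ) ≤ n := by exact_mod_cast hj
    have hk0 : (0 : ℝ) ≤ k := by positivity
    have hj0 : (0 : ℝ) ≤ j := by positivity
    have hn0 : (0 : ℝ) < n := by linarith
    have hnk : (0 : ℝ) < n - k := by linarith
    have e1 : r n j (k + 1) = (((j - k : ℕ) : ℝ) / (n - k)) * r n j k := by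
      rw [r, r, Nat.descFactorial_succ, Nat.descFactorial_succ]
      push_cast [h3.le]
      rw [mul_div_mul_comm]
    have e2 : |((j - k : ℕ) : ℝ) / (n - k) - j / n| ≤ ε / 2 := by
      refine le_trans ?_ h2
      rcases le_total k j with hkj | hkj
      · push_cast [hkj]
        have : ((j : ℝ) - k) / (n - k) - j / n = - ((k / (n - k)) * ((n - j) / n)) := by
          field_simp; ring
        rw [this, abs_neg, abs_of_nonneg (by have : (0:ℝ) ≤ n - j := by linarith
                                             positivity)]
        apply mul_le_of_le_one_right (by positivity)
        rw [div_le_one hn0]; linarith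
      · rw [Nat.sub_eq_zero_of_le hkj]
        have : (j : ℝ) ≤ k := by exact_mod_cast hkj
        simp only [Nat.cast_zero, zero_div, zero_sub, abs_neg]
        rw [abs_of_nonneg (by positivity)]
        gcongr
        linarith
    have hr := r_mem n j k hj
    have hq : (j : ℝ) / n ≤ 1 := by rw [div_le_one hn0]; exact hjn
    have hq0 : 0 ≤ (j : ℝ) / n := by positivity
    have e3 : r n j (k + 1) - ((j : ℝ) / n) ^ (k + 1) =
        (((j - k : ℕ) : ℝ) / (n - k) - j / n) * r n j k
          + (j / n) * (r n j k - ((j : ℝ) / n) ^ k) := by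
      rw [e1]; ring
    rw [e3]
    refine (abs_add_le _ _).trans ?_
    rw [abs_mul, abs_mul, abs_of_nonneg hr.1, abs_of_nonneg hq0]
    have a1 := mul_le_mul e2 hr.2 hr.1 (by positivity)
    have a2 := mul_le_mul hq (h1 j hj) (abs_nonneg _) zero_le_one
    linarith

lemma prod_diff (s : Finset (Fin d)) (a b : Fin d → ℝ) (ha : ∀ i, 0 ≤ a i ∧ a i ≤ 1)
    (hb : ∀ i, 0 ≤ b i ∧ b i ≤ 1) (ε : ℝ) (h : ∀ i, |a i - b i| ≤ ε) :
    |∏ i ∈ s, a i - ∏ i ∈ s, b i| ≤ s.card * ε := by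
  classical
  induction s using Finset.induction_on with
  | empty => simp
  | insert i s hi ih =>
    rw [Finset.prod_insert hi, Finset.prod_insert hi, Finset.card_insert_of_notMem hi]
    have e : a i * ∏ j ∈ s, a j - b i * ∏ j ∈ s, b j =
      (a i - b i) * ∏ j ∈ s, a j + b i * (∏ j ∈ s, a j - ∏ j ∈ s, b j) := by ring
    have p0 : 0 ≤ ∏ j ∈ s, a j := Finset.prod_nonneg fun j _ => (ha j).1
    have p1 : ∏ j ∈ s, a j ≤ 1 := Finset.prod_le_one (fun j _ => (ha j).1) fun j _ => (ha j).2
    rw [e]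
    refine (abs_add_le _ _).trans ?_
    rw [abs_mul, abs_mul, abs_of_nonneg p0, abs_of_nonneg (hb i).1]
    have a1 := mul_le_mul (h i) p1 p0 ((abs_nonneg _).trans (h i))
    have a2 := mul_le_mul (hb i).2 ih (abs_nonneg _) zero_le_one
    push_cast
    linarith

lemma prod_Y (n : ℕ) (k : Fin d → ℕ) (hk : ∀ i, k i ≤ n) :
    ∏ i, Y i ^ k i = ∑ J ∈ Fintype.piFinset (fun _ : Fin d => Finset.range (n + 1)),
      C (∏ i, r n (J i) (k i)) * ∏ i, B n (J i) i := by
  rw [Finset.prod_congr rfl fun i _ => Y_pow n (k i) (hk i) i, Finset.prod_univ_sum]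
  simp only [Finset.prod_mul_distrib, map_prod]

theorem main (f : MvPolynomial (Fin d) ℝ)
    (hf : ∀ x : Fin d → ℝ, (∀ i, x i ∈ Set.Icc (-1 : ℝ) 1) → 0 ≤ eval x f) : QMb d f := by
  apply QMb.of_QMb
  intro ε hε
  set g : MvPolynomial (Fin d) ℝ := aeval (fun i => 2 * X i - 1) f with hg
  have hfg : f = aeval (fun i => Y i) g := by
    rw [hg, ← AlgHom.comp_apply, comp_aeval]
    conv_lhs => rw [← aeval_X_left_apply f]
    congr 2
    funext i
    simp only [map_sub, map_mul, aeval_X, map_one, map_ofNat, Y]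
    linear_combination (- (1 + X i)) * C_half (d := d)
  have hgpos : ∀ y : Fin d → ℝ, (∀ i, 0 ≤ y i ∧ y i ≤ 1) → 0 ≤ eval y g := by
    intro y hy
    have : eval y g = eval (fun i => 2 * y i - 1) f := by
      rw [hg, ← coe_aeval_eq_eval, ← coe_aeval_eq_eval]
      simp only [RingHom.coe_coe]
      rw [← AlgHom.comp_apply, comp_aeval]
      simp
    rw [this]
    refine hf _ fun i => ⟨?_, ?_⟩ <;> linarith [(hy i).1, (hy i).2]
  set S : ℝ := ∑ k ∈ g.support, |g.coeff k| with hS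
  have hS0 : 0 ≤ S := Finset.sum_nonneg fun _ _ => abs_nonneg _
  set η : ℝ := ε / (S * d + 1) with hη
  have hη0 : 0 < η := by positivity
  have hηb : S * (d * η) ≤ ε := by
    rw [hη, ← mul_assoc, mul_div_assoc', div_le_iff₀ (by positivity)]
    nlinarith
  have hev : ∀ᶠ n : ℕ in Filter.atTop, ∀ k ∈ g.support, ∀ i : Fin d,
      k i ≤ n ∧ ∀ j ≤ n, |r n j (k i) - ((j : ℝ) / n) ^ k i| ≤ η := by
    rw [Filter.eventually_all_finset]
    intro k _
    rw [Filter.eventually_all]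
    intro i
    exact (Filter.eventually_ge_atTop (k i)).and (r_lim (k i) η hη0)
  obtain ⟨n, hn⟩ := hev.exists
  set I := Fintype.piFinset (fun _ : Fin d => Finset.range (n + 1)) with hI
  have h1 : ∑ J ∈ I, ∏ i, B n (J i) i = (1 : MvPolynomial (Fin d) ℝ) := by
    have := prod_Y (d := d) n (fun _ => 0) (by simp)
    simpa [r] using this.symm
  have h2 : f = ∑ J ∈ I, C (∑ k ∈ g.support, g.coeff k * ∏ i, r n (J i) (k i)) *
      ∏ i, B n (J i) i := by
    rw [hfg, aeval_def, eval₂_eq']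
    simp only [map_sum, Finset.sum_mul]
    rw [Finset.sum_comm]
    refine Finset.sum_congr rfl fun k hk => ?_
    rw [prod_Y n k fun i => (hn k hk i).1, Finset.mul_sum]
    refine Finset.sum_congr rfl fun J _ => ?_
    rw [C_mul, algebraMap_eq, mul_assoc]
  have h3 : f + C ε = ∑ J ∈ I, C ((∑ k ∈ g.support, g.coeff k * ∏ i, r n (J i) (k i)) + ε) *
      ∏ i, B n (J i) i := by
    simp only [C_add (a' := ε), add_mul, Finset.sum_add_distrib]
    rw [← h2, ← Finset.mul_sum, h1, mul_one]
  rw [h3]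
  refine QMb_sum _ _ fun J hJ => (QMb_prod n J _).smul ?_
  have hJ' : ∀ i, J i ≤ n := by
    intro i
    have := Fintype.mem_piFinset.1 hJ i
    exact Nat.lt_succ_iff.1 (Finset.mem_range.1 this)
  have hy : ∀ i, 0 ≤ (J i : ℝ) / n ∧ (J i : ℝ) / n ≤ 1 := fun i =>
    ⟨by positivity, div_le_one_of_le₀ (by exact_mod_cast hJ' i) (by positivity)⟩
  have hpos := hgpos (fun i => (J i : ℝ) / n) hy
  rw [eval_eq'] at hpos
  have hd : |∑ k ∈ g.support, g.coeff k * ∏ i, r n (J i) (k i) -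
      ∑ k ∈ g.support, g.coeff k * ∏ i, ((J i : ℝ) / n) ^ k i| ≤ ε := by
    refine le_trans ?_ hηb
    rw [← Finset.sum_sub_distrib, hS, Finset.sum_mul]
    refine (Finset.abs_sum_le_sum_abs _ _).trans (Finset.sum_le_sum fun k hk => ?_)
    rw [← mul_sub, abs_mul]
    refine mul_le_mul_of_nonneg_left ?_ (abs_nonneg _)
    have := prod_diff Finset.univ (fun i => r n (J i) (k i)) (fun i => ((J i : ℝ) / n) ^ k i)
      (fun i => r_mem _ _ _ (hJ' i))
      (fun i => ⟨pow_nonneg (hy i).1 _, pow_le_one₀ (hy i).1 (hy i).2⟩) η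
      (fun i => (hn k hk i).2 _ (hJ' i))
    simpa using this
  linarith [(abs_le.1 hd).1]

end HC

/-- Positivstellensatz for the hypercube `[-1,1]^d`: a real polynomial `f` in `d`
commuting variables is nonnegative on `[-1,1]^d` if and only if, for every `ε > 0`,
`f + ε` lies in the quadratic module generated by the elements `1 - Xᵢ²`, i.e.
`f + ε = Σ_k p_k² + Σ_i Σ_k q_{i,k}² (1 - Xᵢ²)`. -/
theorem hypercube_positivstellensatz (d : ℕ) (f : MvPolynomial (Fin d) ℝ) :
    (∀ x : Fin d → ℝ, (∀ i, x i ∈ Set.Icc (-1 : ℝ) 1) → 0 ≤ MvPolynomial.eval x f)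
    ↔ (∀ ε : ℝ, 0 < ε →
        ∃ (n m : ℕ) (p : Fin n → MvPolynomial (Fin d) ℝ)
          (q : Fin d → Fin m → MvPolynomial (Fin d) ℝ),
          f + MvPolynomial.C ε =
            (∑ k, p k ^ 2) +
            ∑ i, ∑ k, q i k ^ 2 * (1 - MvPolynomial.X i ^ 2)) := by
  constructor
  · intro hf ε hε
    exact (HC.main f hf ε hε).rep
  · intro h x hx
    refine le_of_forall_pos_le_add fun ε hε => ?_
    obtain ⟨n, m, p, q, e⟩ := h ε hε
    have e' := congrArg (MvPolynomial.eval x) e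
    simp only [map_add, map_sum, map_mul, map_pow, map_sub, map_one, MvPolynomial.eval_C,
      MvPolynomial.eval_X] at e'
    rw [e']
    refine add_nonneg (Finset.sum_nonneg fun _ _ => sq_nonneg _)
      (Finset.sum_nonneg fun i _ => Finset.sum_nonneg fun _ _ => mul_nonneg (sq_nonneg _) ?_)
    have := hx i
    nlinarith [this.1, this.2]
end

section
/- Let A be a semi-pre-C*-algebra over ℂ and a ∈ A hermitian. Let K_h be the ℝ-linear span of {x*x − xx* : x ∈ A}. Then τ(a) ≥ 0 for every tracial state τ on A if and only if for every real ε > 0 there exist p ∈ A₊ and k ∈ K_h with a + ε·1 = p + k. -/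
/-- A state on a semi-pre-C*-algebra `(A, P)`. -/
structure IsStateOn {A : Type*} [Ring A] [Algebra ℂ A] [StarRing A]
    (P : Set A) (φ : A →ₗ[ℂ] ℂ) : Prop where
  map_one : φ 1 = 1
  map_star : ∀ x : A, φ (star x) = starRingEnd ℂ (φ x)
  pos : ∀ a ∈ P, ∃ r : ℝ, 0 ≤ r ∧ φ a = r

section helpers
variable {A : Type*} [Ring A] [Algebra ℂ A] [StarRing A]

/-- The real span of the elements `x* x - x x*`. -/
def commSpan (A : Type*) [Ring A] [Algebra ℂ A] [StarRing A] : Submodule ℝ A :=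
  Submodule.span ℝ (Set.range fun x : A => star x * x - x * star x)

theorem rsmul (r : ℝ) (x : A) : r • x = (r : ℂ) • x := rfl

theorem mem_smul {P : Set A} (hP : IsSemiPreCstarCone A P) {r : ℝ} (hr : 0 ≤ r) {x : A}
    (hx : x ∈ P) : r • x ∈ P := by
  have h0 : (0 : A) ∈ P := by simpa using hP.smul_one_mem 0 le_rfl
  simpa using hP.smul_add_mem r hr x hx 0 h0

theorem mem_add {P : Set A} (hP : IsSemiPreCstarCone A P) {x y : A}
    (hx : x ∈ P) (hy : y ∈ P) : x + y ∈ P := by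
  simpa using hP.smul_add_mem 1 zero_le_one x hx y hy

theorem mem_sq {P : Set A} (hP : IsSemiPreCstarCone A P) (x : A) : star x * x ∈ P := by
  have h1 : (1 : A) ∈ P := by simpa using hP.smul_one_mem 1 zero_le_one
  simpa using hP.conj_mem 1 h1 x

theorem star_rsmul_one {P : Set A} (hP : IsSemiPreCstarCone A P) (r : ℝ) :
    star (r • (1 : A)) = r • (1 : A) := by
  rcases le_total 0 r with h | h
  · exact hP.herm _ (hP.smul_one_mem r h)
  · have := hP.herm _ (hP.smul_one_mem (-r) (by linarith))
    rw [← rsmul, neg_smul, star_neg] at this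
    exact neg_injective this

theorem star_rsmul {P : Set A} (hP : IsSemiPreCstarCone A P) (r : ℝ) (x : A) :
    star (r • x) = r • star x := by
  have : r • x = (r • (1 : A)) * x := by simp
  rw [this, star_mul, star_rsmul_one hP]
  simp

/-- Elements whose hermitian part lies in the cone plus the commutator span. -/
def bigCone {P : Set A} (hP : IsSemiPreCstarCone A P) : PointedCone ℝ A where
  carrier := {s | ∃ p ∈ P, ∃ k ∈ commSpan A, s + star s = p + k}
  zero_mem' := ⟨0, by simpa using hP.smul_one_mem 0 le_rfl, 0, zero_mem _, by simp⟩
  add_mem' := by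
    rintro x y ⟨p, hp, k, hk, h⟩ ⟨q, hq, l, hl, h'⟩
    refine ⟨p + q, mem_add hP hp hq, k + l, add_mem hk hl, ?_⟩
    rw [star_add, add_add_add_comm, h, h']; abel
  smul_mem' := by
    rintro ⟨c, hc⟩ x ⟨p, hp, k, hk, h⟩
    refine ⟨c • p, mem_smul hP hc hp, c • k, Submodule.smul_mem _ _ hk, ?_⟩
    change c • x + star (c • x) = _
    rw [star_rsmul hP, ← smul_add, h, smul_add]

theorem bigCone_smul {P : Set A} (hP : IsSemiPreCstarCone A P) {c : ℝ} (hc : 0 ≤ c) {x : A}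
    (hx : x ∈ bigCone hP) : c • x ∈ bigCone hP :=
  (bigCone hP).smul_mem hc hx

theorem P_le {P : Set A} (hP : IsSemiPreCstarCone A P) {x : A} (hx : x ∈ P) :
    x ∈ bigCone hP :=
  ⟨x + x, mem_add hP hx hx, 0, zero_mem _, by rw [hP.herm x hx, add_zero]⟩

theorem unit_dense {P : Set A} (hP : IsSemiPreCstarCone A P) (y : A) :
    ∃ R : ℝ, R • (1 : A) + y ∈ bigCone hP := by
  obtain ⟨R, hR, h⟩ := hP.archimedean (1 - (y + star y))
  have h2 := mem_add hP h (mem_sq hP (y + star y))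
  have h3 := mem_smul hP (r := 1/2) (by norm_num) h2
  refine ⟨(R - 1) / 4, _, h3, 0, zero_mem _, ?_⟩
  rw [star_add, star_rsmul_one hP, ← rsmul]
  have hs : star (y + star y) = y + star y := by rw [star_add, star_star, add_comm]
  generalize hh : y + star y = w at hs ⊢
  have : ((R - 1) / 4) • (1 : A) + y + (((R - 1) / 4) • (1 : A) + star y) =
    ((R - 1) / 2) • (1 : A) + w := by rw [← hh]; module
  rw [this, star_sub, hs, star_one]
  have e : (1 - w) * (1 - w) = 1 - (2 : ℝ) • w + w * w := by
    rw [two_smul]; noncomm_ring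
  rw [e]; module

/-- Separation. -/
theorem exists_sep {P : Set A} (hP : IsSemiPreCstarCone A P) (b : A) (hb : b ∉ bigCone hP) :
    ∃ g : A →ₗ[ℝ] ℝ, g 1 = 1 ∧ (∀ x ∈ bigCone hP, 0 ≤ g x) ∧ g b ≤ 0 := by
  have one_mem : (1 : A) ∈ bigCone hP := P_le hP (by simpa using hP.smul_one_mem 1 zero_le_one)
  let S : PointedCone ℝ A :=
    { carrier := {s | ∃ t : ℝ, 0 ≤ t ∧ s + t • b ∈ bigCone hP}
      zero_mem' := ⟨0, le_rfl, by simp⟩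
      add_mem' := by
        rintro x y ⟨t, ht, h⟩ ⟨u, hu, h'⟩
        refine ⟨t + u, add_nonneg ht hu, ?_⟩
        convert add_mem h h' using 1
        module
      smul_mem' := by
        rintro ⟨c, hc⟩ x ⟨t, ht, h⟩
        refine ⟨c * t, mul_nonneg hc ht, ?_⟩
        have := bigCone_smul hP hc h
        rwa [smul_add, smul_smul] at this }
  have hS : ∀ x ∈ bigCone hP, x ∈ S := fun x hx => ⟨0, le_rfl, by simpa using hx⟩
  have h10 : (1 : A) ≠ 0 := by
    intro h
    apply hb
    have : b = 0 := by rw [← mul_one b, h, mul_zero]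
    rw [this]; exact zero_mem _
  obtain ⟨g, hg, hpos⟩ := riesz_extension S (LinearPMap.mkSpanSingleton (1 : A) (1 : ℝ) h10)
    (by
      rintro ⟨x, hx⟩ hxS
      obtain ⟨r, rfl⟩ := Submodule.mem_span_singleton.1 hx
      erw [LinearPMap.mkSpanSingleton'_apply]
      simp only [smul_eq_mul, mul_one]
      by_contra hr
      push Not at hr
      rw [RingHom.id_apply] at hr
      obtain ⟨t, ht, h⟩ := hxS
      apply hb
      simp only at h
      rcases ht.eq_or_lt with rfl | ht
      · obtain ⟨R, hR⟩ := unit_dense hP b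
        have h1 := bigCone_smul hP (c := |R| / (-r)) (div_nonneg (abs_nonneg _) (by linarith)) h
        have h2 := bigCone_smul hP (c := |R| - R) (by linarith [le_abs_self R]) one_mem
        have h3 := add_mem (add_mem h1 h2) hR
        convert h3 using 1
        rw [zero_smul, add_zero, smul_smul]
        have : |R| / -r * r = -|R| := by
          have := hr.ne
          field_simp
        rw [this]; module
      · have h1 := bigCone_smul hP (c := t⁻¹) (by positivity) h
        have h2 := bigCone_smul hP (c := t⁻¹ * (-r)) (mul_nonneg (by positivity) (by linarith))
          one_mem
        convert add_mem h1 h2 using 1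
        rw [smul_add, smul_smul, smul_smul, inv_mul_cancel₀ ht.ne']
        module)
    (by
      intro y
      obtain ⟨R, hR⟩ := unit_dense hP y
      exact ⟨⟨R • (1 : A), Submodule.mem_span_singleton.2 ⟨R, rfl⟩⟩, hS _ hR⟩)
  refine ⟨g, ?_, fun x hx => hpos x (hS x hx), ?_⟩
  · have := hg ⟨1, Submodule.mem_span_singleton_self _⟩
    rw [this]
    exact LinearPMap.mkSpanSingleton_apply ℝ ℝ h10 (1 : ℝ)
  · have := hpos (-b) ⟨1, zero_le_one, by simp⟩
    rw [map_neg] at this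
    linarith

end helpers

/-- The tracial Positivstellensatz of Klep–Schweighofer in the setting of
semi-pre-C*-algebras: a hermitian element `a` satisfies `τ(a) ≥ 0` for every tracial
state `τ` if and only if, for every `ε > 0`, `a + ε·1 = p + k` with `p ∈ A₊` and `k`
in the real linear span of the commutator differences `x*x − xx*`. -/
theorem tracial_positivstellensatz
    {A : Type*} [Ring A] [Algebra ℂ A] [StarRing A]
    (P : Set A) (hP : IsSemiPreCstarCone A P) (a : A) (ha : star a = a) :
    (∀ τ : A →ₗ[ℂ] ℂ, IsStateOn P τ → (∀ x y : A, τ (x * y) = τ (y * x)) →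
        ∃ r : ℝ, 0 ≤ r ∧ τ a = r)
    ↔ (∀ ε : ℝ, 0 < ε →
        ∃ p ∈ P, ∃ (n : ℕ) (t : Fin n → ℝ) (x : Fin n → A),
          a + (ε : ℂ) • (1 : A) =
            p + ∑ i, (t i : ℂ) • (star (x i) * x i - x i * star (x i))) := by
  constructor
  · intro H ε hε
    by_cases hb : a + ε • (1 : A) ∈ bigCone hP
    · obtain ⟨p, hp, k, hk, h⟩ := hb
      rw [star_add, ha, star_rsmul_one hP] at h
      have hk' : (1/2 : ℝ) • k ∈ commSpan A := Submodule.smul_mem _ _ hk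
      obtain ⟨n, t, x, hx⟩ := Submodule.mem_span_set'.1 hk'
      choose y hy using fun i => (x i).2
      refine ⟨(1/2 : ℝ) • p, mem_smul hP (by norm_num) hp, n, t, y, ?_⟩
      have e : ∑ i, (t i : ℂ) • (star (y i) * y i - y i * star (y i)) = (1/2 : ℝ) • k := by
        rw [← hx]
        refine Finset.sum_congr rfl fun i _ => ?_
        rw [← hy i]; rfl
      rw [e, ← smul_add, ← h, ← rsmul]; module
    · exfalso
      obtain ⟨g, g1, gpos, gb⟩ := exists_sep hP _ hb
      -- symmetry under star
      have ganti : ∀ z : A, star z = -z → g z = 0 := by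
        intro z hz
        have h1 := gpos z ⟨0, by simpa using hP.smul_one_mem 0 le_rfl, 0, zero_mem _, by simp [hz]⟩
        have h2 := gpos (-z)
          ⟨0, by simpa using hP.smul_one_mem 0 le_rfl, 0, zero_mem _, by simp [hz]⟩
        rw [map_neg] at h2; linarith
      have gstar : ∀ z, g (star z) = g z := by
        intro z
        have := ganti (star z - z) (by simp)
        rw [map_sub] at this; linarith
      have gcomm0 : ∀ x : A, g (star x * x - x * star x) = 0 := by
        intro x
        have hm : star x * x - x * star x ∈ commSpan A := Submodule.subset_span ⟨x, rfl⟩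
        have hs : star (star x * x - x * star x) = star x * x - x * star x := by simp
        have h1 := gpos _ ⟨0, by simpa using hP.smul_one_mem 0 le_rfl, _, add_mem hm hm,
          by rw [hs, zero_add]⟩
        have h2 := gpos (-(star x * x - x * star x))
          ⟨0, by simpa using hP.smul_one_mem 0 le_rfl, _, add_mem (neg_mem hm) (neg_mem hm),
          by rw [star_neg, hs, zero_add]⟩
        rw [map_neg] at h2; linarith
      have gcomm : ∀ x y : A, g (x * y) = g (y * x) := by
        intro x y
        have h1 := gcomm0 (star x + y)
        have h2 := gcomm0 (star x)
        have h3 := gcomm0 y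
        have h4 := gstar (x * y)
        have h5 := gstar (y * x)
        simp only [star_add, star_star, star_mul, add_mul, mul_add, map_add, map_sub] at *
        linarith
      -- the part on which the star fails to be conjugate linear
      let j : A := Complex.I • (1 : A)
      have jc : ∀ x, j * x = x * j := by intro x; simp [j]
      have uc : ∀ x, star j * x = x * star j := by
        intro x
        have := congrArg star (jc (star x))
        simpa using this.symm
      have jj : j * j = -1 := by simp [j, smul_smul]
      let F : A := 1 - star j * j
      have Fc : ∀ x, F * x = x * F := by
        intro x
        simp only [F, sub_mul, mul_sub, one_mul, mul_one]
        rw [mul_assoc, jc, ← mul_assoc, uc, mul_assoc]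
      have ee : star j * j * (star j * j) = 1 := by
        have h : star j * star j = -1 := by rw [← star_mul, jj]; simp
        calc star j * j * (star j * j) = star j * (j * star j) * j := by noncomm_ring
          _ = (star j * star j) * (j * j) := by rw [jc]; noncomm_ring
          _ = 1 := by rw [h, jj]; simp
      have Fs : star F = F := by simp [F]
      have FF : F * F = (2 : ℝ) • F := by
        have : F * F = 1 - 2 * (star j * j) + star j * j * (star j * j) := by
          simp only [F]; noncomm_ring
        rw [this, ee, two_smul]; simp only [F]; noncomm_ring
      have eF : star j * j * F = -F := by
        simp only [F, mul_sub, ee]; noncomm_ring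
      have gFx : ∀ x : A, g (F * (star x * x)) = 0 := by
        intro x
        have e1 : star (F * x) * (F * x) = (2 : ℝ) • (F * (star x * x)) := by
          rw [star_mul, Fs, ← smul_mul_assoc, ← FF]
          calc star x * F * (F * x) = (star x * F) * (F * x) := rfl
            _ = F * star x * (F * x) := by rw [← Fc]
            _ = F * (star x * F) * x := by noncomm_ring
            _ = _ := by rw [← Fc]; noncomm_ring
        have e2 : star (j * (F * x)) * (j * (F * x)) = -((2 : ℝ) • (F * (star x * x))) := by
          rw [← e1]
          calc star (j * (F * x)) * (j * (F * x))
              = star (F * x) * ((star j * j * F) * x) := by rw [star_mul]; noncomm_ring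
            _ = _ := by rw [eF]; noncomm_ring
        have h1 := gpos _ (P_le hP (mem_sq hP (F * x)))
        have h2 := gpos _ (P_le hP (mem_sq hP (j * (F * x))))
        rw [e1] at h1
        rw [e2] at h2
        simp only [map_neg, map_smul, smul_eq_mul] at h1 h2
        linarith
      have gFh : ∀ h : A, star h = h → g (F * h) = 0 := by
        intro h hh
        have h1 := gFx (1 + h)
        have h2 := gFx (1 - h)
        simp only [star_add, star_sub, star_one, hh, add_mul, mul_add, sub_mul, mul_sub, one_mul,
          mul_one, map_add, map_sub] at h1 h2
        linarith
      have gF : ∀ x : A, g (F * x) = 0 := by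
        intro x
        have h1 := gFh (x + star x) (by rw [star_add, star_star, add_comm])
        have h2 := gstar (F * x)
        rw [star_mul, Fs, ← Fc] at h2
        rw [mul_add, map_add] at h1
        linarith
      have guj : ∀ x : A, g (star j * x) = - g (j * x) := by
        intro x
        have h := gF (j * x)
        have : F * (j * x) = j * x + star j * x := by
          calc F * (j * x) = j * x - star j * (j * j) * x := by simp only [F]; noncomm_ring
            _ = _ := by rw [jj]; noncomm_ring
        rw [this, map_add] at h
        linarith
      have gj : ∀ x : A, g (j * star x) = - g (j * x) := by
        intro x
        rw [← gstar (j * star x), star_mul, star_star, ← uc, guj]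
      have gjh : ∀ x : A, star x = x → g (j * x) = 0 := by
        intro x hx
        have := gj x
        rw [hx] at this; linarith
      let τ : A →ₗ[ℂ] ℂ :=
        { toFun := fun x => (g x : ℂ) - Complex.I * (g (j * x) : ℂ)
          map_add' := by
            intro x y
            simp only [mul_add, map_add]; push_cast; ring
          map_smul' := by
            intro c x
            have hc : c • x = c.re • x + c.im • (j * x) := by
              rw [rsmul, rsmul]
              simp only [j, smul_mul_assoc, one_mul, smul_smul, ← add_smul]
              rw [Complex.re_add_im]
            have hjc : j * (c • x) = c.re • (j * x) - c.im • x := by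
              rw [hc, mul_add, mul_smul_comm, mul_smul_comm, ← mul_assoc, jj]
              simp [sub_eq_add_neg]
            rw [hjc, hc]
            simp only [map_add, map_sub, map_smul, smul_eq_mul, RingHom.id_apply]
            apply Complex.ext <;> simp <;> ring }
      have hτ : ∀ x, τ x = (g x : ℂ) - Complex.I * (g (j * x) : ℂ) := fun _ => rfl
      have hτh : ∀ x, star x = x → τ x = (g x : ℂ) := by
        intro x hx
        rw [hτ, gjh x hx]; simp
      obtain ⟨r, hr, hra⟩ := H τ
        { map_one := by rw [hτh _ (star_one A), g1]; simp
          map_star := by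
            intro x
            rw [hτ, hτ, gstar, gj]
            apply Complex.ext <;> simp
          pos := fun p hp => ⟨g p, gpos p (P_le hP hp), hτh p (hP.herm p hp)⟩ }
        (by
          intro x y
          rw [hτ, hτ, gcomm x y, ← mul_assoc, gcomm (j * x) y, ← mul_assoc, ← jc, mul_assoc])
      rw [hτh a ha] at hra
      have : g a = r := by exact_mod_cast hra
      rw [map_add, map_smul, g1, smul_eq_mul] at gb
      linarith
  · intro H τ hτ htr
    have hre : τ a = ((τ a).re : ℂ) := by
      have := hτ.map_star a
      rw [ha] at this
      exact (Complex.conj_eq_iff_re.1 this.symm).symm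
    refine ⟨(τ a).re, ?_, hre⟩
    refine le_of_forall_pos_le_add fun ε hε => ?_
    obtain ⟨p, hp, n, t, x, h⟩ := H ε hε
    obtain ⟨r, hr, hrp⟩ := hτ.pos p hp
    have h2 := congrArg τ h
    rw [map_add, map_add, map_smul, hτ.map_one, map_sum] at h2
    have : ∀ i, τ ((t i : ℂ) • (star (x i) * x i - x i * star (x i))) = 0 := by
      intro i
      rw [map_smul, map_sub, htr, sub_self, smul_zero]
    simp only [this, hrp] at h2
    have h3 := congrArg Complex.re h2
    simp at h3
    linarith
end

section
/- Let A and B be unital C*-algebras, S ⊆ A a unital *-subspace, and φ : S → B a unital, self-adjoint, completely positive map (for every n and every positive matrix [a_{ij}] in the C*-algebra Mₙ(A) with all entries in S, the matrix [φ(a_{ij})] is positive in Mₙ(B)). Assume that the set G = {x ∈ S : x*x ≤ 1 in A and φ(x) is a unitary element of B} generates a dense *-subalgebra of A. Then there exists a unital *-homomorphism π : A → B with π(x) = φ(x) for all x ∈ S. -/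
open scoped Matrix

namespace PisierAux

set_option linter.unusedSectionVars false

section abs
variable {M : Type*} [CStarAlgebra M] [PartialOrder M] [StarOrderedRing M]

lemma perturb (T E D K : M) (hT : IsSelfAdjoint T) (hED : E + D = 1)
    (hE : 0 ≤ star E * T * E) (hD : star D * D ≤ K) (ε : ℝ) (hε : 0 < ε) :
    ∃ C : ℝ, 0 ≤ T + (C : ℂ) • K + (ε : ℂ) • (1 : M) := by
  simp only [Complex.coe_smul]
  obtain ⟨δ, hδ, hδE⟩ : ∃ δ : ℝ, 0 < δ ∧ δ * ‖E‖ ^ 2 ≤ ε := by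
    refine ⟨ε / (‖E‖ ^ 2 + 1), by positivity, ?_⟩
    rw [div_mul_eq_mul_div, div_le_iff₀ (by positivity)]
    nlinarith
  have h1 : 0 ≤ δ⁻¹ • (star (δ • E + T * D) * (δ • E + T * D)) :=
    smul_nonneg (by positivity) (star_mul_self_nonneg _)
  have h2 : 0 ≤ ε • (1 : M) - δ • (star E * E) := by
    have := CStarAlgebra.star_mul_le_algebraMap_norm_sq (a := E)
    have h3 := smul_le_smul_of_nonneg_left this hδ.le
    rw [Algebra.algebraMap_eq_smul_one, smul_smul] at h3
    rw [sub_nonneg]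
    refine h3.trans ?_
    rw [← sub_nonneg, ← sub_smul]
    exact smul_nonneg (by linarith) zero_le_one
  have h3 : 0 ≤ ‖T‖ • (star D * D) + star D * T * D := by
    have := CStarAlgebra.star_left_conjugate_le_norm_smul (a := D) (b := -T) hT.neg
    rw [norm_neg, mul_neg, neg_mul] at this
    have := sub_nonneg.2 this
    rwa [sub_neg_eq_add] at this
  have h4 : 0 ≤ δ⁻¹ • (‖T * T‖ • (star D * D) - star D * (T * T) * D) := by
    refine smul_nonneg (by positivity) (sub_nonneg.2 ?_)
    apply CStarAlgebra.star_left_conjugate_le_norm_smul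
    rw [isSelfAdjoint_iff, star_mul, hT.star_eq]
  have h5 : 0 ≤ (δ⁻¹ * ‖T * T‖ + ‖T‖) • (K - star D * D) :=
    smul_nonneg (by positivity) (sub_nonneg.2 hD)
  refine ⟨δ⁻¹ * ‖T * T‖ + ‖T‖, ?_⟩
  have h0 : T = star E * T * E + star E * T * D + star D * T * E + star D * T * D := by
    have : T = star (E + D) * T * (E + D) := by rw [hED]; simp
    conv_lhs => rw [this]
    rw [star_add]; noncomm_ring
  have key : T + (δ⁻¹ * ‖T * T‖ + ‖T‖) • K + ε • (1 : M) =
     star E * T * E + δ⁻¹ • (star (δ • E + T * D) * (δ • E + T * D))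
      + (ε • (1 : M) - δ • (star E * E)) + (‖T‖ • (star D * D) + star D * T * D)
      + δ⁻¹ • (‖T * T‖ • (star D * D) - star D * (T * T) * D)
      + (δ⁻¹ * ‖T * T‖ + ‖T‖) • (K - star D * D) := by
    have e1 : δ⁻¹ • (star (δ • E + T * D) * (δ • E + T * D)) = δ • (star E * E)
      + star E * T * D + star D * T * E + δ⁻¹ • (star D * (T * T) * D) := by
      rw [star_add, star_smul, star_mul, hT.star_eq, star_trivial]
      simp only [add_mul, mul_add, smul_mul_assoc, mul_smul_comm, smul_add, smul_smul,
        mul_assoc, inv_mul_cancel₀ hδ.ne', one_smul, inv_mul_cancel_left₀ hδ.ne']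
      abel
    rw [e1]
    generalize ‖T * T‖ = c1
    generalize ‖T‖ = c2
    conv_lhs => rw [h0]
    module
  rw [key]
  positivity

lemma nonneg_of_forall_eps (a : M) (h : ∀ ε : ℝ, 0 < ε → 0 ≤ a + (ε : ℂ) • (1 : M)) : 0 ≤ a := by
  simp only [Complex.coe_smul] at h
  have hc := CStarAlgebra.isClosed_nonneg (A := M)
  have ht : Filter.Tendsto (fun ε : ℝ => a + ε • (1 : M)) (nhdsWithin 0 (Set.Ioi 0)) (nhds a) := by
    have : Continuous (fun ε : ℝ => a + ε • (1 : M)) := by fun_prop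
    have := (this.tendsto 0).mono_left (nhdsWithin_le_nhds (s := Set.Ioi 0))
    simpa using this
  exact hc.mem_of_tendsto ht (Filter.eventually_of_mem self_mem_nhdsWithin fun ε hε => h ε hε)

lemma exists_star_mul {a : M} (h : 0 ≤ a) : ∃ c : M, a = star c * c :=
  CStarAlgebra.nonneg_iff_eq_star_mul_self.1 h

lemma smul_half_nonneg {a : M} (h : 0 ≤ a + a) : 0 ≤ a := by
  have h2 : 0 ≤ (2⁻¹ : ℝ) • (a + a) := smul_nonneg (by norm_num) h
  have : (2⁻¹ : ℝ) • (a + a) = a := by module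
  rwa [this] at h2

end abs

section block
variable {A : Type*} [CStarAlgebra A] [PartialOrder A] [StarOrderedRing A]
variable {ι : Type*} [Fintype ι] [DecidableEq ι]

def block (a b c d : CStarMatrix ι ι A) : CStarMatrix (ι ⊕ ι) (ι ⊕ ι) A :=
  CStarMatrix.ofMatrix (Matrix.fromBlocks (CStarMatrix.ofMatrix.symm a)
    (CStarMatrix.ofMatrix.symm b) (CStarMatrix.ofMatrix.symm c) (CStarMatrix.ofMatrix.symm d))

lemma block_mul (a b c d a' b' c' d' : CStarMatrix ι ι A) :
    block a b c d * block a' b' c' d' =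
      block (a * a' + b * c') (a * b' + b * d') (c * a' + d * c') (c * b' + d * d') :=
  Matrix.fromBlocks_multiply (CStarMatrix.ofMatrix.symm a)
    (CStarMatrix.ofMatrix.symm b) (CStarMatrix.ofMatrix.symm c) (CStarMatrix.ofMatrix.symm d)
    (CStarMatrix.ofMatrix.symm a')
    (CStarMatrix.ofMatrix.symm b') (CStarMatrix.ofMatrix.symm c') (CStarMatrix.ofMatrix.symm d')

lemma block_add (a b c d a' b' c' d' : CStarMatrix ι ι A) :
    block a b c d + block a' b' c' d' = block (a + a') (b + b') (c + c') (d + d') :=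
  Matrix.fromBlocks_add (CStarMatrix.ofMatrix.symm a)
    (CStarMatrix.ofMatrix.symm b) (CStarMatrix.ofMatrix.symm c) (CStarMatrix.ofMatrix.symm d)
    (CStarMatrix.ofMatrix.symm a')
    (CStarMatrix.ofMatrix.symm b') (CStarMatrix.ofMatrix.symm c') (CStarMatrix.ofMatrix.symm d')

lemma block_star (a b c d : CStarMatrix ι ι A) :
    star (block a b c d) = block (star a) (star c) (star b) (star d) :=
  Matrix.fromBlocks_conjTranspose (CStarMatrix.ofMatrix.symm a)
    (CStarMatrix.ofMatrix.symm b) (CStarMatrix.ofMatrix.symm c) (CStarMatrix.ofMatrix.symm d)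

lemma block_smul (r : ℂ) (a b c d : CStarMatrix ι ι A) :
    r • (block a b c d) = block (r • a) (r • b) (r • c) (r • d) := by
  ext i j
  rcases i with i | i <;> rcases j with j | j <;> rfl

lemma block_one : (1 : CStarMatrix (ι ⊕ ι) (ι ⊕ ι) A) = block 1 0 0 1 :=
  (Matrix.fromBlocks_one (l := ι) (m := ι) (α := A)).symm

lemma block_corner_nonneg {a : CStarMatrix ι ι A} (ha : 0 ≤ a) : 0 ≤ block a 0 0 0 := by
  obtain ⟨c, rfl⟩ := exists_star_mul ha
  have : block (star c * c) 0 0 0 = star (block c 0 0 0) * block c 0 0 0 := by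
    simp [block_star, block_mul]
  rw [this]; exact star_mul_self_nonneg _

lemma corner_nonneg_of_block {a b c d : CStarMatrix ι ι A} (h : 0 ≤ block a b c d) : 0 ≤ a := by
  obtain ⟨e, he⟩ := exists_star_mul h
  obtain ⟨p, q, r, s, rfl⟩ : ∃ p q r s, e = block p q r s := by
    refine ⟨CStarMatrix.ofMatrix fun i j => e (.inl i) (.inl j),
      CStarMatrix.ofMatrix fun i j => e (.inl i) (.inr j),
      CStarMatrix.ofMatrix fun i j => e (.inr i) (.inl j),
      CStarMatrix.ofMatrix fun i j => e (.inr i) (.inr j), ?_⟩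
    ext i j
    rcases i with i | i <;> rcases j with j | j <;> rfl
  rw [block_star, block_mul] at he
  have : a = star p * p + star r * r := by
    ext i j
    exact congrFun (congrFun he (.inl i)) (.inl j)
  rw [this]
  exact add_nonneg (star_mul_self_nonneg _) (star_mul_self_nonneg _)

def diag (ι : Type*) [DecidableEq ι] {A : Type*} [Zero A] (x : A) : CStarMatrix ι ι A :=
  CStarMatrix.ofMatrix (Matrix.diagonal fun _ => x)

lemma diag_mul_apply (x : A) (t : CStarMatrix ι ι A) (i j : ι) :
    (diag ι x * t) i j = x * t i j :=
  Matrix.diagonal_mul (fun _ => x) (CStarMatrix.ofMatrix.symm t) i j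

lemma mul_diag_apply (x : A) (t : CStarMatrix ι ι A) (i j : ι) :
    (t * diag ι x) i j = t i j * x :=
  Matrix.mul_diagonal (fun _ => x) (CStarMatrix.ofMatrix.symm t) i j

lemma diag_star (x : A) : star (diag ι x) = diag ι (star x) :=
  Matrix.diagonal_conjTranspose (fun _ => x)

lemma diag_mul_diag (x y : A) : diag ι x * diag ι y = diag ι (x * y) :=
  Matrix.diagonal_mul_diagonal (fun _ => x) (fun _ => y)

lemma diag_one : diag ι (1 : A) = 1 := Matrix.diagonal_one

lemma one_sub_diag (x : A) : 1 - diag ι x = diag ι (1 - x) := by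
  rw [← diag_one]
  exact (Matrix.diagonal_sub (fun _ => (1 : A)) (fun _ => x))

lemma diag_apply (x : A) (i j : ι) : diag ι x i j = if i = j then x else 0 := rfl

lemma diag_nonneg {x : A} (hx : 0 ≤ x) : 0 ≤ diag ι x := by
  obtain ⟨c, rfl⟩ := exists_star_mul hx
  rw [← diag_mul_diag, ← diag_star]; exact star_mul_self_nonneg _

lemma of_one_by_one {y : A} (h : 0 ≤ (CStarMatrix.ofMatrix fun _ _ => y :
    CStarMatrix (Fin 1) (Fin 1) A)) : 0 ≤ y := by
  obtain ⟨c, hc⟩ := exists_star_mul h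
  have e : y = (star c * c) 0 0 := congrFun (congrFun hc 0) 0
  rw [e, CStarMatrix.mul_apply]
  simp only [Finset.univ_unique, Finset.sum_singleton, CStarMatrix.star_apply]
  exact star_mul_self_nonneg _

end block


section rel
variable {A : Type*} [CStarAlgebra A] [PartialOrder A] [StarOrderedRing A]
variable {B : Type*} [CStarAlgebra B] [PartialOrder B] [StarOrderedRing B]

/-- completely positive relation -/
def CPRel (Γ : Submodule ℂ (A × B)) : Prop :=
  ∀ (n : ℕ) (a : CStarMatrix (Fin n) (Fin n) A) (b : CStarMatrix (Fin n) (Fin n) B),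
    (∀ i j, (a i j, b i j) ∈ Γ) → 0 ≤ a → 0 ≤ b

lemma CPRel.gen {Γ : Submodule ℂ (A × B)} (h : CPRel Γ) {ι : Type*} [Fintype ι]
    (a : CStarMatrix ι ι A) (b : CStarMatrix ι ι B)
    (hab : ∀ i j, (a i j, b i j) ∈ Γ) (ha : 0 ≤ a) : 0 ≤ b := by
  let e := Fintype.equivFin ι
  have h1 := h _ (CStarMatrix.reindexₐ ℂ A e a) (CStarMatrix.reindexₐ ℂ B e b)
    (fun i j => hab (e.symm i) (e.symm j)) (map_nonneg _ ha)
  have h2 := map_nonneg (CStarMatrix.reindexₐ ℂ B e).symm h1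
  simpa using h2

lemma CPRel.one {Γ : Submodule ℂ (A × B)} (h : CPRel Γ) (a : A) (b : B)
    (hab : (a, b) ∈ Γ) (ha : 0 ≤ a) : 0 ≤ b := by
  apply of_one_by_one
  refine h 1 (CStarMatrix.ofMatrix fun _ _ => a) _ (fun i j => hab) ?_
  convert diag_nonneg (ι := Fin 1) ha using 1
  ext i j
  rw [diag_apply, if_pos (Subsingleton.elim i j)]
  rfl

variable (Γ : Submodule ℂ (A × B))

/-- one step extension -/
def ext (x : A) (u : B) : Submodule ℂ (A × B) where
  carrier := {p | ∃ q ∈ Γ, ∃ r ∈ Γ, ∃ s ∈ Γ,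
    p = (q.1 + x * r.1 + s.1 * star x, q.2 + u * r.2 + s.2 * star u)}
  zero_mem' := ⟨0, Γ.zero_mem, 0, Γ.zero_mem, 0, Γ.zero_mem, by simp; rfl⟩
  add_mem' := by
    rintro _ _ ⟨q, hq, r, hr, s, hs, rfl⟩ ⟨q', hq', r', hr', s', hs', rfl⟩
    refine ⟨_, Γ.add_mem hq hq', _, Γ.add_mem hr hr', _, Γ.add_mem hs hs', ?_⟩
    ext
    · simp [mul_add, add_mul]; abel
    · simp [mul_add, add_mul]; abel
  smul_mem' := by
    rintro c _ ⟨q, hq, r, hr, s, hs, rfl⟩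
    refine ⟨_, Γ.smul_mem c hq, _, Γ.smul_mem c hr, _, Γ.smul_mem c hs, ?_⟩
    ext <;> simp

lemma le_ext (x : A) (u : B) : Γ ≤ ext Γ x u := fun q hq =>
  ⟨q, hq, 0, Γ.zero_mem, 0, Γ.zero_mem, by simp⟩

lemma mul_mem_ext (x : A) (u : B) (a : A) (b : B) (h : (a, b) ∈ Γ) :
    (x * a, u * b) ∈ ext Γ x u :=
  ⟨0, Γ.zero_mem, _, h, 0, Γ.zero_mem, by simp⟩

variable {Γ}

lemma star_mem_ext (hstar : ∀ p ∈ Γ, star p ∈ Γ) (x : A) (u : B) :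
    ∀ p ∈ ext Γ x u, star p ∈ ext Γ x u := by
  rintro _ ⟨q, hq, r, hr, s, hs, rfl⟩
  refine ⟨_, hstar q hq, _, hstar s hs, _, hstar r hr, ?_⟩
  ext
  · simp; abel
  · simp; abel

lemma ext_herm (hΓ : CPRel Γ) (h1 : ((1 : A), (1 : B)) ∈ Γ) (hstar : ∀ p ∈ Γ, star p ∈ Γ)
    {x : A} {u : B} (hxu : (x, u) ∈ Γ) (hx : 0 ≤ 1 - x * star x) (hu : u * star u = 1)
    {ι : Type*} [Fintype ι] [DecidableEq ι]
    (a : CStarMatrix ι ι A) (b : CStarMatrix ι ι B)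
    (hab : ∀ i j, (a i j, b i j) ∈ ext Γ x u) (ha : 0 ≤ a) : 0 ≤ b + star b := by
  choose q hq r hr s hs hqrs using hab
  let X : CStarMatrix ι ι A := diag ι x
  let U : CStarMatrix ι ι B := diag ι u
  let Q : CStarMatrix ι ι A := CStarMatrix.ofMatrix fun i j => (q i j).1
  let R : CStarMatrix ι ι A := CStarMatrix.ofMatrix fun i j => (r i j).1
  let S : CStarMatrix ι ι A := CStarMatrix.ofMatrix fun i j => (s i j).1
  let Q' : CStarMatrix ι ι B := CStarMatrix.ofMatrix fun i j => (q i j).2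
  let R' : CStarMatrix ι ι B := CStarMatrix.ofMatrix fun i j => (r i j).2
  let S' : CStarMatrix ι ι B := CStarMatrix.ofMatrix fun i j => (s i j).2
  have ea : a = Q + X * R + S * star X := by
    ext i j
    rw [diag_star, CStarMatrix.add_apply, CStarMatrix.add_apply, diag_mul_apply, mul_diag_apply]
    exact congrArg Prod.fst (hqrs i j)
  have eb : b = Q' + U * R' + S' * star U := by
    ext i j
    rw [diag_star, CStarMatrix.add_apply, CStarMatrix.add_apply, diag_mul_apply, mul_diag_apply]
    exact congrArg Prod.snd (hqrs i j)
  have hQ : ∀ i j, (Q i j, Q' i j) ∈ Γ := fun i j => hq i j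
  have hR : ∀ i j, (R i j, R' i j) ∈ Γ := fun i j => hr i j
  have hS : ∀ i j, (S i j, S' i j) ∈ Γ := fun i j => hs i j
  clear_value Q R S Q' R' S'
  clear hqrs hq hr hs
  have hX : 0 ≤ 1 - X * star X := by
    rw [diag_star, diag_mul_diag, one_sub_diag]; exact diag_nonneg hx
  have hU : U * star U = 1 := by
    rw [diag_star, diag_mul_diag, hu, diag_one]
  have hXU : ∀ i j, (X i j, U i j) ∈ Γ := by
    intro i j
    change ((if i = j then x else 0, if i = j then u else 0) : A × B) ∈ Γ
    split_ifs
    exacts [hxu, Γ.zero_mem]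
  have h11 : ∀ i j : ι, ((1 : CStarMatrix ι ι A) i j, (1 : CStarMatrix ι ι B) i j) ∈ Γ := by
    intro i j
    rw [CStarMatrix.one_apply, CStarMatrix.one_apply]
    split_ifs
    exacts [h1, Γ.zero_mem]
  have hst : ∀ (Y : CStarMatrix ι ι A) (Z : CStarMatrix ι ι B), (∀ i j, (Y i j, Z i j) ∈ Γ) →
      ∀ i j, (star Y i j, star Z i j) ∈ Γ := fun Y Z h i j => hstar _ (h j i)
  clear_value X U
  have ha' : 0 ≤ a + star a := by
    rw [(IsSelfAdjoint.of_nonneg ha).star_eq]; exact add_nonneg ha ha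
  let T : CStarMatrix (ι ⊕ ι) (ι ⊕ ι) A := block (Q + star Q) (S + star R) (R + star S) 0
  let T' : CStarMatrix (ι ⊕ ι) (ι ⊕ ι) B := block (Q' + star Q') (S' + star R') (R' + star S') 0
  apply nonneg_of_forall_eps
  intro ε hε
  obtain ⟨C, hC⟩ := perturb T (block 1 0 (star X) 0) (block 0 0 (-star X) 1)
    (block 1 (-X) (-star X) 1) (by
      rw [isSelfAdjoint_iff, block_star]; simp [T, add_comm]) (by
      rw [block_add, block_one]; simp) (by
      rw [block_star, block_mul, block_mul]
      simp only [star_one, star_star, star_zero, one_mul, mul_one, zero_mul, mul_zero, add_zero, zero_add]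
      have e : Q + star Q + X * (R + star S) + (S + star R) * star X = a + star a := by
        rw [ea]; simp only [star_add, star_mul, star_star, mul_add, add_mul]; abel
      rw [e]
      exact block_corner_nonneg ha') (by
      rw [← sub_nonneg]
      have := block_corner_nonneg hX
      convert this using 1
      rw [sub_eq_iff_eq_add, block_star, block_mul, block_add]
      simp) (ε / 2) (by positivity)
  have hB := hΓ.gen _ (T' + (C : ℂ) • block 1 (-U) (-star U) 1 +
    ((ε / 2 : ℝ) : ℂ) • (1 : CStarMatrix (ι ⊕ ι) (ι ⊕ ι) B)) (by
      have hadd : ∀ (Y Y' : CStarMatrix ι ι A) (Z Z' : CStarMatrix ι ι B),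
          (∀ i j, (Y i j, Z i j) ∈ Γ) → (∀ i j, (Y' i j, Z' i j) ∈ Γ) →
          ∀ i j, ((Y + Y') i j, (Z + Z') i j) ∈ Γ := fun _ _ _ _ h h' i j =>
            Γ.add_mem (h i j) (h' i j)
      have hneg : ∀ (Y : CStarMatrix ι ι A) (Z : CStarMatrix ι ι B),
          (∀ i j, (Y i j, Z i j) ∈ Γ) →
          ∀ i j, ((-Y) i j, (-Z) i j) ∈ Γ := fun _ _ h i j => Γ.neg_mem (h i j)
      have hsm : ∀ (c : ℂ) (Y : CStarMatrix ι ι A) (Z : CStarMatrix ι ι B),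
          (∀ i j, (Y i j, Z i j) ∈ Γ) →
          ∀ i j, ((c • Y) i j, (c • Z) i j) ∈ Γ := fun c _ _ h i j => Γ.smul_mem c (h i j)
      have h00 : ∀ i j : ι, ((0 : CStarMatrix ι ι A) i j, (0 : CStarMatrix ι ι B) i j) ∈ Γ :=
        fun _ _ => Γ.zero_mem
      simp only [T, T', block_one, block_smul, block_add]
      have hbl : ∀ (Y1 Y2 Y3 Y4 : CStarMatrix ι ι A) (Z1 Z2 Z3 Z4 : CStarMatrix ι ι B),
        (∀ i j, (Y1 i j, Z1 i j) ∈ Γ) → (∀ i j, (Y2 i j, Z2 i j) ∈ Γ) →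
        (∀ i j, (Y3 i j, Z3 i j) ∈ Γ) → (∀ i j, (Y4 i j, Z4 i j) ∈ Γ) →
        ∀ i j, (block Y1 Y2 Y3 Y4 i j, block Z1 Z2 Z3 Z4 i j) ∈ Γ := by
        intro Y1 Y2 Y3 Y4 Z1 Z2 Z3 Z4 h1 h2 h3 h4 i j
        rcases i with i | i <;> rcases j with j | j
        exacts [h1 i j, h2 i j, h3 i j, h4 i j]
      apply hbl <;> refine hadd _ _ _ _ (hadd _ _ _ _ ?_ (hsm _ _ _ ?_)) (hsm _ _ _ ?_)
      all_goals first
        | exact h11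
        | exact h00
        | exact hneg _ _ hXU
        | exact hneg _ _ (hst _ _ hXU)
        | exact hadd _ _ _ _ hQ (hst _ _ hQ)
        | exact hadd _ _ _ _ hS (hst _ _ hR)
        | exact hadd _ _ _ _ hR (hst _ _ hS)) hC
  have hB2 := star_left_conjugate_nonneg hB (block 1 0 (star U) 0)
  simp only [T', block_one, block_smul, block_add, block_star, block_mul] at hB2
  have hB3 := corner_nonneg_of_block hB2
  convert hB3 using 1
  rw [eb]
  simp only [star_one, star_star, star_zero, one_mul, mul_one, zero_mul, mul_zero, add_zero,
    zero_add, smul_zero, star_add, star_mul, mul_add, add_mul, smul_neg, mul_neg, neg_mul,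
    mul_smul_comm, smul_mul_assoc, hU]
  push_cast
  have h2 : (ε : ℂ) • (1 : CStarMatrix ι ι B) = ((ε : ℂ) / 2) • 1 + ((ε : ℂ) / 2) • 1 := by
    rw [← add_smul, add_halves]
  rw [h2]
  abel

lemma ext_zero (hΓ : CPRel Γ) (h1 : ((1 : A), (1 : B)) ∈ Γ) (hstar : ∀ p ∈ Γ, star p ∈ Γ)
    {x : A} {u : B} (hxu : (x, u) ∈ Γ) (hx : 0 ≤ 1 - x * star x) (hu : u * star u = 1)
    (y : B) (hy : (0, y) ∈ ext Γ x u) : y = 0 := by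
  have key : ∀ z : B, (0, z) ∈ ext Γ x u → 0 ≤ z + star z := by
    intro z hz
    have := ext_herm hΓ h1 hstar hxu hx hu (ι := Fin 1) 0 (CStarMatrix.ofMatrix fun _ _ => z)
      (fun i j => hz) le_rfl
    exact of_one_by_one this
  have key2 : ∀ z : B, (0, z) ∈ ext Γ x u → z + star z = 0 := by
    intro z hz
    refine le_antisymm ?_ (key z hz)
    have h := key (-z) (by simpa using (ext Γ x u).neg_mem hz)
    rw [star_neg, ← neg_add] at h
    exact neg_nonneg.1 h
  have e1 := key2 y hy
  have e2 := key2 (Complex.I • y) (by simpa using (ext Γ x u).smul_mem Complex.I hy)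
  rw [star_smul] at e2
  have e3 : star y = -y := by rw [eq_neg_iff_add_eq_zero, add_comm]; exact e1
  rw [e3] at e2
  simp only [RCLike.star_def, Complex.conj_I, smul_neg, neg_smul, neg_neg] at e2
  rw [← two_smul ℂ, smul_smul] at e2
  exact (smul_eq_zero.1 e2).resolve_left (by simp)

lemma ext_cp (hΓ : CPRel Γ) (h1 : ((1 : A), (1 : B)) ∈ Γ) (hstar : ∀ p ∈ Γ, star p ∈ Γ)
    {x : A} {u : B} (hxu : (x, u) ∈ Γ) (hx : 0 ≤ 1 - x * star x) (hu : u * star u = 1) :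
    CPRel (ext Γ x u) := by
  intro n a b hab ha
  have h := ext_herm hΓ h1 hstar hxu hx hu a b hab ha
  have hb : star b = b := by
    ext i j
    have h2 := (ext Γ x u).sub_mem (star_mem_ext hstar x u _ (hab j i)) (hab i j)
    have e : star (a j i) = a i j :=
      congrFun (congrFun (IsSelfAdjoint.of_nonneg ha).star_eq i) j
    have h3 : (0, star (b j i) - b i j) ∈ ext Γ x u := by
      convert h2 using 1
      ext <;> simp [e]
    exact sub_eq_zero.1 (ext_zero hΓ h1 hstar hxu hx hu _ h3)
  rw [hb] at h
  exact smul_half_nonneg h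

lemma bound_herm (hΓ : CPRel Γ) (h1 : ((1 : A), (1 : B)) ∈ Γ)
    (a : A) (b : B) (hp : (a, b) ∈ Γ) (ha : IsSelfAdjoint a) (hb : IsSelfAdjoint b) :
    ‖b‖ ≤ ‖a‖ := by
  have key : ∀ (a : A) (b : B), (a, b) ∈ Γ → IsSelfAdjoint a → b ≤ algebraMap ℝ B ‖a‖ := by
    intro a b hp ha
    have h2 := ha.le_algebraMap_norm_self
    rw [Algebra.algebraMap_eq_smul_one, ← Complex.coe_smul] at h2 ⊢
    exact sub_nonneg.1 (hΓ.one _ _ (Γ.sub_mem (Γ.smul_mem ((‖a‖ : ℝ) : ℂ) h1) hp)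
      (sub_nonneg.2 h2))
  have k1 := key a b hp ha
  have k2 := key (-a) (-b) (Γ.neg_mem hp) ha.neg
  rw [norm_neg] at k2
  nontriviality B
  rcases CStarAlgebra.norm_or_neg_norm_mem_spectrum hb with h | h
  · exact (le_algebraMap_iff_spectrum_le hb).1 k1 _ h
  · have := (le_algebraMap_iff_spectrum_le hb.neg).1 k2 ‖b‖ (by
      rw [← spectrum.neg_eq]; simpa using h)
    exact this

lemma bound (hΓ : CPRel Γ) (h1 : ((1 : A), (1 : B)) ∈ Γ) (hstar : ∀ p ∈ Γ, star p ∈ Γ)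
    (p : A × B) (hp : p ∈ Γ) : ‖p.2‖ ≤ 2 * ‖p.1‖ := by
  obtain ⟨a, b⟩ := p
  have hs : (star a, star b) ∈ Γ := hstar _ hp
  have e1 := bound_herm hΓ h1 (a + star a) (b + star b) (Γ.add_mem hp hs)
    (IsSelfAdjoint.add_star_self a) (IsSelfAdjoint.add_star_self b)
  have e2 := bound_herm hΓ h1 (Complex.I • (a - star a)) (Complex.I • (b - star b))
    (Γ.smul_mem _ (Γ.sub_mem hp hs))
    (by rw [isSelfAdjoint_iff, star_smul]; simp [smul_sub]; abel)
    (by rw [isSelfAdjoint_iff, star_smul]; simp [smul_sub]; abel)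
  rw [norm_smul, norm_smul, Complex.norm_I, one_mul, one_mul] at e2
  have n1 := norm_add_le a (star a)
  have n2 := norm_sub_le a (star a)
  rw [norm_star] at n1 n2
  have n3 := norm_add_le (b + star b) (b - star b)
  have e3 : (b + star b) + (b - star b) = (2 : ℂ) • b := by rw [two_smul]; abel
  rw [e3, norm_smul] at n3
  norm_num at n3
  change ‖b‖ ≤ 2 * ‖a‖
  linarith

/-- good relations -/
def Good (Γ : Submodule ℂ (A × B)) : Prop := CPRel Γ ∧ ∀ p ∈ Γ, star p ∈ Γ

lemma exists_maximal (Γ₀ : Submodule ℂ (A × B)) (h : Good Γ₀) :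
    ∃ Γ, Γ₀ ≤ Γ ∧ Maximal Good Γ := by
  refine zorn_le_nonempty₀ {Γ | Good Γ} (fun c hc hchain y hy => ?_) Γ₀ h
  have hdir := hchain.directedOn
  have hmem : ∀ p, p ∈ sSup c ↔ ∃ Γ ∈ c, p ∈ Γ := fun p =>
    Submodule.mem_sSup_of_directed ⟨y, hy⟩ hdir
  refine ⟨sSup c, ⟨?_, ?_⟩, fun z hz => le_sSup hz⟩
  · intro n a b hab ha
    have hfin : ∃ Γ ∈ c, ∀ p ∈ (Finset.univ : Finset (Fin n × Fin n)),
        (a p.1 p.2, b p.1 p.2) ∈ Γ := by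
      induction (Finset.univ : Finset (Fin n × Fin n)) using Finset.induction_on with
      | empty => exact ⟨y, hy, by simp⟩
      | insert q s hq ih =>
        obtain ⟨Γ1, hΓ1, h1⟩ := ih
        obtain ⟨Γ2, hΓ2, h2⟩ := (hmem _).1 (hab q.1 q.2)
        obtain ⟨Γ3, hΓ3, h13, h23⟩ := hdir Γ1 hΓ1 Γ2 hΓ2
        refine ⟨Γ3, hΓ3, fun p hp => ?_⟩
        rcases Finset.mem_insert.1 hp with rfl | hp
        · exact h23 h2
        · exact h13 (h1 p hp)
    obtain ⟨Γ, hΓ, h2⟩ := hfin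
    exact (hc hΓ).1 n a b (fun i j => h2 (i, j) (Finset.mem_univ _)) ha
  · intro p hp
    obtain ⟨Γ, hΓ, h2⟩ := (hmem p).1 hp
    exact (hmem _).2 ⟨Γ, hΓ, (hc hΓ).2 p h2⟩

lemma one_sub_mul_star {x : A} (h : 0 ≤ 1 - star x * x) : 0 ≤ 1 - x * star x := by
  rw [sub_nonneg] at h ⊢
  rw [← CStarAlgebra.norm_le_one_iff_of_nonneg _ (mul_star_self_nonneg x),
    CStarRing.norm_self_mul_star]
  rwa [← CStarAlgebra.norm_le_one_iff_of_nonneg _ (star_mul_self_nonneg x),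
    CStarRing.norm_star_mul_self] at h

theorem main (Γ₀ : Submodule ℂ (A × B)) (h : Good Γ₀) (h1 : ((1 : A), (1 : B)) ∈ Γ₀)
    (G : Set A) (hG : ∀ x ∈ G, 0 ≤ 1 - star x * x ∧ ∃ u ∈ unitary B, (x, u) ∈ Γ₀)
    (hd : Dense ((StarAlgebra.adjoin ℂ G : StarSubalgebra ℂ A) : Set A)) :
    ∃ π : A →⋆ₐ[ℂ] B, ∀ p ∈ Γ₀, π p.1 = p.2 := by
  obtain ⟨Γ, hle, hmax⟩ := exists_maximal Γ₀ h
  have hg := hmax.1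
  replace h1 := hle h1
  have hbd := bound hg.1 h1 hg.2
  have hstep : ∀ x u, (x, u) ∈ Γ → 0 ≤ 1 - x * star x → u * star u = 1 →
      ∀ a b, (a, b) ∈ Γ → (x * a, u * b) ∈ Γ := by
    intro x u hxu hx hu a b hab
    have hle2 : ext Γ x u ≤ Γ := hmax.2 ⟨ext_cp hg.1 h1 hg.2 hxu hx hu, star_mem_ext hg.2 x u⟩
      (le_ext Γ x u)
    exact hle2 (mul_mem_ext Γ x u a b hab)
  have halg : ∀ a ∈ StarAlgebra.adjoin ℂ G, ∃ b, ∀ s t, (s, t) ∈ Γ → (a * s, b * t) ∈ Γ := by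
    intro a ha
    change a ∈ Algebra.adjoin ℂ (G ∪ star G) at ha
    induction ha using Algebra.adjoin_induction with
    | mem x hx =>
      rcases hx with hx | hx
      · obtain ⟨h2, u, hu, hxu⟩ := hG x hx
        exact ⟨u, hstep x u (hle hxu) (one_sub_mul_star h2) (Unitary.mul_star_self_of_mem hu)⟩
      · obtain ⟨h2, u, hu, hxu⟩ := hG _ hx
        refine ⟨star u, hstep x (star u) ?_ ?_ ?_⟩
        · have := hg.2 _ (hle hxu)
          rwa [Prod.star_def, star_star] at this
        · simpa using h2
        · simpa using Unitary.star_mul_self_of_mem hu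
    | algebraMap r =>
      refine ⟨algebraMap ℂ B r, fun s t hst => ?_⟩
      simpa [Algebra.algebraMap_eq_smul_one] using Γ.smul_mem r hst
    | add x y hx hy ihx ihy =>
      obtain ⟨b, hb⟩ := ihx
      obtain ⟨c, hc⟩ := ihy
      exact ⟨b + c, fun s t hst => by
        simpa [add_mul] using Γ.add_mem (hb s t hst) (hc s t hst)⟩
    | mul x y hx hy ihx ihy =>
      obtain ⟨b, hb⟩ := ihx
      obtain ⟨c, hc⟩ := ihy
      exact ⟨b * c, fun s t hst => by
        simpa [mul_assoc] using hb _ _ (hc s t hst)⟩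
  let e : Γ →ₗ[ℂ] A := (LinearMap.fst ℂ A B).comp Γ.subtype
  let f : Γ →ₗ[ℂ] B := (LinearMap.snd ℂ A B).comp Γ.subtype
  have hde : DenseRange e := by
    refine hd.mono fun a ha => ?_
    obtain ⟨b, hb⟩ := halg a ha
    have := hb 1 1 h1
    rw [mul_one, mul_one] at this
    exact ⟨⟨_, this⟩, rfl⟩
  let g : A →L[ℂ] B := f.extendOfNorm e
  have hgΓ : ∀ a b, (a, b) ∈ Γ → g a = b := fun a b hab =>
    LinearMap.extendOfNorm_eq hde ⟨2, fun x => hbd x.1 x.2⟩ ⟨_, hab⟩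
  have hg1 : g 1 = 1 := hgΓ _ _ h1
  have hgstar : ∀ a, g (star a) = star (g a) := by
    intro a
    refine hde.induction_on (p := fun a => g (star a) = star (g a)) a
      (isClosed_eq (by fun_prop) (by fun_prop)) ?_
    rintro ⟨⟨a, b⟩, hab⟩
    change g (star a) = star (g a)
    rw [hgΓ a b hab]
    exact hgΓ _ _ (hg.2 _ hab)
  have hgmul : ∀ a s, g (a * s) = g a * g s := by
    intro a s
    refine hde.induction_on (p := fun s => g (a * s) = g a * g s) s
      (isClosed_eq (by fun_prop) (by fun_prop)) ?_
    rintro ⟨⟨s, t⟩, hst⟩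
    change g (a * s) = g a * g s
    have hcl : IsClosed {a | g (a * s) = g a * g s} :=
      isClosed_eq (by fun_prop) (by fun_prop)
    refine hcl.closure_subset_iff.2 ?_ (hd a)
    intro a ha
    obtain ⟨b, hb⟩ := halg a ha
    have hb1 := hb 1 1 h1
    rw [mul_one, mul_one] at hb1
    change g (a * s) = g a * g s
    rw [hgΓ _ _ (hb s t hst), hgΓ _ _ hst, hgΓ _ _ hb1]
  refine ⟨{ AlgHom.ofLinearMap (g : A →ₗ[ℂ] B) hg1 hgmul with map_star' := hgstar },
    fun p hp => hgΓ p.1 p.2 (hle hp)⟩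

end rel
end PisierAux


/-- Pisier's linearization trick: let `S` be a unital *-subspace of a unital
C*-algebra `A` and `φ : S → B` a unital self-adjoint completely positive map into a
unital C*-algebra `B`. If the set of `x ∈ S` with `x*x ≤ 1` (i.e. `1 − x*x` positive
in `A`) whose image `φ(x)` is unitary in `B` generates a dense *-subalgebra of `A`,
then `φ` extends to a unital *-homomorphism `π : A → B`. Positivity of a matrix over
a C*-algebra is expressed as being of the form `cᴴ * c`. -/
theorem pisier_linearization_trick
    {A : Type*} [CStarAlgebra A] {B : Type*} [CStarAlgebra B]
    (S : Submodule ℂ A) (hone : (1 : A) ∈ S) (hstar : ∀ x ∈ S, star x ∈ S)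
    (φ : S →ₗ[ℂ] B)
    (hunital : φ ⟨1, hone⟩ = 1)
    (hsa : ∀ (x : A) (hx : x ∈ S), φ ⟨star x, hstar x hx⟩ = star (φ ⟨x, hx⟩))
    (hcp : ∀ (n : ℕ) (a : Matrix (Fin n) (Fin n) A) (ha : ∀ i j, a i j ∈ S),
        (∃ b : Matrix (Fin n) (Fin n) A, a = bᴴ * b) →
        ∃ c : Matrix (Fin n) (Fin n) B,
          (Matrix.of fun i j => φ ⟨a i j, ha i j⟩) = cᴴ * c)
    (hgen : Dense ((StarAlgebra.adjoin ℂ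
        {x : A | ∃ hx : x ∈ S, (∃ b : A, 1 - star x * x = star b * b) ∧
          φ ⟨x, hx⟩ ∈ unitary B} : StarSubalgebra ℂ A) : Set A)) :
    ∃ π : A →⋆ₐ[ℂ] B, ∀ (x : A) (hx : x ∈ S), π x = φ ⟨x, hx⟩ := by
  let _ := CStarAlgebra.spectralOrder A
  have := CStarAlgebra.spectralOrderedRing A
  let _ := CStarAlgebra.spectralOrder B
  have := CStarAlgebra.spectralOrderedRing B
  have hmem : ∀ p : A × B, p ∈ LinearMap.range (S.subtype.prod φ) ↔
      ∃ hx : p.1 ∈ S, φ ⟨p.1, hx⟩ = p.2 := by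
    rintro ⟨a, b⟩
    constructor
    · rintro ⟨x, hx⟩
      obtain ⟨rfl, rfl⟩ := Prod.ext_iff.1 hx
      exact ⟨x.2, rfl⟩
    · rintro ⟨hx, h⟩
      exact ⟨⟨a, hx⟩, Prod.ext rfl h⟩
  have hg1 : PisierAux.CPRel (LinearMap.range (S.subtype.prod φ)) := by
    intro n a b hab ha
    obtain ⟨c, hc⟩ := PisierAux.exists_star_mul ha
    have hS : ∀ i j, a i j ∈ S := fun i j => ((hmem _).1 (hab i j)).1
    obtain ⟨d, hd⟩ := hcp n (CStarMatrix.ofMatrix.symm a) hS ⟨CStarMatrix.ofMatrix.symm c, hc⟩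
    have hb : b = star (CStarMatrix.ofMatrix d) * CStarMatrix.ofMatrix d := by
      refine Eq.trans ?_ hd
      ext i j
      exact ((hmem _).1 (hab i j)).2.symm
    rw [hb]
    exact star_mul_self_nonneg _
  have hg2 : ∀ p ∈ LinearMap.range (S.subtype.prod φ), star p ∈ LinearMap.range (S.subtype.prod φ) := by
    intro p hp
    obtain ⟨hx, h⟩ := (hmem p).1 hp
    exact (hmem _).2 ⟨hstar _ hx, (hsa _ hx).trans (congrArg star h)⟩
  have hg3 : ∀ x ∈ {x : A | ∃ hx : x ∈ S, (∃ b : A, 1 - star x * x = star b * b) ∧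
      φ ⟨x, hx⟩ ∈ unitary B}, 0 ≤ 1 - star x * x ∧
      ∃ u ∈ unitary B, (x, u) ∈ LinearMap.range (S.subtype.prod φ) := by
    rintro x ⟨hx, ⟨b, hb⟩, hu⟩
    exact ⟨hb ▸ star_mul_self_nonneg b, _, hu, (hmem _).2 ⟨hx, rfl⟩⟩
  obtain ⟨π, hπ⟩ := PisierAux.main (LinearMap.range (S.subtype.prod φ)) ⟨hg1, hg2⟩
    ((hmem _).2 ⟨hone, hunital⟩) _ hg3 hgen
  exact ⟨π, fun x hx => hπ (x, φ ⟨x, hx⟩) ((hmem _).2 ⟨hx, rfl⟩)⟩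
end
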